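/- There exist a constant c ≥ 1 and, for each n ≥ 0, a symmetric function κ_n : V_n × V_n → [0,∞), with associated quadratic forms D̃_n(f) := Σ κ_n(x,y)(f(x)−f(y))² (sum over unordered pairs {x,y} ⊆ V_n), such that: (a) c⁻¹·𝓡_n·D_n(f) ≤ D̃_n(f) ≤ c·𝓡_n·D_n(f) for all n ≥ 0 and all f : V_n → ℝ; (b) the decimation formula holds: for all 0 ≤ n ≤ m and every f : V_n → ℝ, D̃_n(f) = min{D̃_m(g) : g : V_m → ℝ, g|_{V_n} = f}. (Existence of a compatible sequence of graph energies; Lemma 4.1 of the paper in the planar case.) -/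

import Mathlib

open Finset
open scoped Classical

namespace Carpet

/-- The contraction map `Ψ_{(a,b)}(x,y) = ((x+a)/L, (y+b)/L)`. -/
noncomputable def Psi (L : ℕ) (p : ℕ × ℕ) (x : ℝ × ℝ) : ℝ × ℝ :=
  ((x.1 + p.1) / L, (x.2 + p.2) / L)

/-- Words of length `n` over the alphabet `A`. -/
abbrev Word (A : Finset (ℕ × ℕ)) (n : ℕ) := Fin n → {p : ℕ × ℕ // p ∈ A}

/-- `Ψ_w = Ψ_{w₁} ∘ ⋯ ∘ Ψ_{w_n}`. -/
noncomputable def PsiW (L : ℕ) {A : Finset (ℕ × ℕ)} {n : ℕ} (w : Word A n) : ℝ × ℝ → ℝ × ℝ :=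
  (List.ofFn fun i => Psi L (w i).1).foldr (· ∘ ·) id

/-- The four corners of the unit square. -/
noncomputable def V0 : Finset (ℝ × ℝ) :=
  {((0 : ℝ), (0 : ℝ)), ((1 : ℝ), (0 : ℝ)), ((1 : ℝ), (1 : ℝ)), ((0 : ℝ), (1 : ℝ))}

/-- The level-`n` vertex set `V_n = ⋃_{w ∈ W_n} Ψ_w(V₀)`. -/
noncomputable def VN (L : ℕ) (A : Finset (ℕ × ℕ)) (n : ℕ) : Finset (ℝ × ℝ) :=
  (Finset.univ : Finset (Word A n)).biUnion fun w => V0.image (PsiW L w)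

/-- Euclidean distance in the plane. -/
noncomputable def eudist (x y : ℝ × ℝ) : ℝ :=
  Real.sqrt ((x.1 - y.1) ^ 2 + (x.2 - y.2) ^ 2)

/-- `n`-adjacency: `x = Ψ_w(p)`, `y = Ψ_w(q)` with `p, q ∈ V₀`, `|p - q| = 1`. -/
def Adj (L : ℕ) (A : Finset (ℕ × ℕ)) (n : ℕ) (x y : ℝ × ℝ) : Prop :=
  ∃ w : Word A n, ∃ p ∈ V0, ∃ q ∈ V0,
    eudist p q = 1 ∧ x = PsiW L w p ∧ y = PsiW L w q

/-- The natural graph energy `D_n(f) = Σ_{x ∼ y} (f x - f y)²`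
(summing over ordered pairs and halving). -/
noncomputable def Dform (L : ℕ) (A : Finset (ℕ × ℕ)) (n : ℕ) (f : ℝ × ℝ → ℝ) : ℝ :=
  (1 / 2) * ∑ x ∈ VN L A n, ∑ y ∈ VN L A n,
    (if Adj L A n x y then (f x - f y) ^ 2 else 0)

/-- The effective resistance between `S` and `T` in the level-`n` graph. -/
noncomputable def EffRes (L : ℕ) (A : Finset (ℕ × ℕ)) (n : ℕ) (S T : Set (ℝ × ℝ)) : ℝ :=
  (sInf {e : ℝ | ∃ f : ℝ × ℝ → ℝ,
      (∀ x ∈ S, f x = 1) ∧ (∀ x ∈ T, f x = 0) ∧ e = Dform L A n f})⁻¹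

/-- `𝓡_n`, the resistance between the corners `(0,0)` and `(1,0)`. -/
noncomputable def RR (L : ℕ) (A : Finset (ℕ × ℕ)) (n : ℕ) : ℝ :=
  EffRes L A n {((0 : ℝ), (0 : ℝ))} {((1 : ℝ), (0 : ℝ))}

/-- `𝓡̄_n`, the resistance between the left and right sides of the unit square. -/
noncomputable def RRbar (L : ℕ) (A : Finset (ℕ × ℕ)) (n : ℕ) : ℝ :=
  EffRes L A n
    ((VN L A n : Set (ℝ × ℝ)) ∩ ({(0 : ℝ)} ×ˢ Set.Icc (0 : ℝ) 1))
    ((VN L A n : Set (ℝ × ℝ)) ∩ ({(1 : ℝ)} ×ˢ Set.Icc (0 : ℝ) 1))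

/-- The standing assumptions on `(L, A)` defining a generalized Sierpiński carpet. -/
structure GoodCarpet (L : ℕ) (A : Finset (ℕ × ℕ)) : Prop where
  three_le : 3 ≤ L
  mem_lt : ∀ p ∈ A, p.1 < L ∧ p.2 < L
  symm_swap : ∀ a b : ℕ, (a, b) ∈ A → (b, a) ∈ A
  symm_reflect : ∀ a b : ℕ, (a, b) ∈ A → (L - 1 - a, b) ∈ A
  connected : IsConnected
    (⋃ p ∈ A, Set.Icc (((p.1 : ℝ) / L, (p.2 : ℝ) / L) : ℝ × ℝ)
      ((((p.1 : ℝ) + 1) / L, ((p.2 : ℝ) + 1) / L) : ℝ × ℝ))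
  flat_border : ∀ a b : ℕ, a < L → b < L →
    (a = 0 ∨ a = L - 1 ∨ b = 0 ∨ b = L - 1) → (a, b) ∈ A
  proper : ∃ a b : ℕ, a < L ∧ b < L ∧ (a, b) ∉ A

/-- The generalized Sierpiński carpet `F`. -/
def carpetF (L : ℕ) (A : Finset (ℕ × ℕ)) : Set (ℝ × ℝ) :=
  ⋂ n : ℕ, ⋃ w : Word A n, PsiW L w '' Set.Icc (((0 : ℝ), (0 : ℝ)) : ℝ × ℝ) ((1 : ℝ), (1 : ℝ))


/-- quadratic form of a conductance -/
noncomputable def QF {X : Type*} (V : Finset X) (k : X → X → ℝ) (f : X → ℝ) : ℝ :=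
  (1 / 2) * ∑ x ∈ V, ∑ y ∈ V, k x y * (f x - f y) ^ 2

theorem QF_congr {X : Type*} (V : Finset X) (k : X → X → ℝ) (f g : X → ℝ)
    (h : ∀ x ∈ V, f x = g x) : QF V k f = QF V k g := by
  unfold QF
  congr 1
  refine Finset.sum_congr rfl fun x hx => Finset.sum_congr rfl fun y hy => ?_
  rw [h x hx, h y hy]

theorem star_mesh {X : Type*} (V : Finset X) (k f : X → ℝ) (hk : ∀ x, 0 ≤ k x) (t : ℝ) :
    ∑ x ∈ V, k x * (f x - t) ^ 2 =
      (1 / 2) * ∑ x ∈ V, ∑ y ∈ V, (k x * k y / ∑ z ∈ V, k z) * (f x - f y) ^ 2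
      + (∑ z ∈ V, k z) * (t - (∑ x ∈ V, k x * f x) / ∑ z ∈ V, k z) ^ 2 := by
  set s := ∑ z ∈ V, k z with hs
  by_cases h0 : s = 0
  · have : ∀ x ∈ V, k x = 0 := (Finset.sum_eq_zero_iff_of_nonneg fun x _ => hk x).1 h0
    rw [Finset.sum_eq_zero fun x hx => by rw [this x hx, zero_mul], h0]
    simp
  · set a := ∑ x ∈ V, k x * f x with ha
    set b := ∑ x ∈ V, k x * (f x) ^ 2 with hb
    have h1 : ∑ x ∈ V, k x * (f x - t) ^ 2 = b - 2 * t * a + t ^ 2 * s := by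
      rw [hb, ha, hs, Finset.mul_sum, Finset.mul_sum, ← Finset.sum_sub_distrib,
        ← Finset.sum_add_distrib]
      refine Finset.sum_congr rfl fun x _ => by ring
    have h2 : ∑ x ∈ V, ∑ y ∈ V, (k x * k y / s) * (f x - f y) ^ 2
        = (2 * s * b - 2 * a ^ 2) / s := by
      have : ∀ x ∈ V, ∑ y ∈ V, (k x * k y / s) * (f x - f y) ^ 2
          = (s * (k x * f x ^ 2) - 2 * a * (k x * f x) + b * k x) / s := by
        intro x _
        rw [ha, hb, hs, Finset.sum_mul, Finset.mul_sum, Finset.sum_mul, Finset.sum_mul,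
          ← Finset.sum_sub_distrib, ← Finset.sum_add_distrib, Finset.sum_div]
        refine Finset.sum_congr rfl fun y _ => by ring
      rw [Finset.sum_congr rfl this, ← Finset.sum_div, Finset.sum_add_distrib,
        Finset.sum_sub_distrib, ← Finset.mul_sum, ← Finset.mul_sum, ← Finset.mul_sum]
      rw [← ha, ← hb, ← hs]; ring
    rw [h1, h2]
    field_simp
    ring

theorem QF_insert {X : Type*} (V : Finset X) (z : X) (hz : z ∉ V) (k : X → X → ℝ)
    (hs : ∀ x y, k x y = k y x) (f : X → ℝ) :
    QF (insert z V) k f = QF V k f + ∑ x ∈ V, k x z * (f x - f z) ^ 2 := by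
  unfold QF
  rw [Finset.sum_insert hz, Finset.sum_insert hz]
  have : ∀ x ∈ V, ∑ y ∈ insert z V, k x y * (f x - f y) ^ 2 =
      k x z * (f x - f z) ^ 2 + ∑ y ∈ V, k x y * (f x - f y) ^ 2 := fun x _ =>
    Finset.sum_insert hz
  rw [Finset.sum_congr rfl this, Finset.sum_add_distrib]
  have h2 : ∑ y ∈ V, k z y * (f z - f y) ^ 2 = ∑ x ∈ V, k x z * (f x - f z) ^ 2 :=
    Finset.sum_congr rfl fun x _ => by rw [hs]; ring
  rw [h2]; ring

/-- the first conductance is a trace of the second one -/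
def IsTr {X : Type*} (V' V : Finset X) (k' k : X → X → ℝ) : Prop :=
  (∀ x y, 0 ≤ k' x y) ∧ (∀ x y, k' x y = k' y x) ∧ (∀ g, QF V' k' g ≤ QF V k g) ∧
  ∀ (f : X → ℝ) (M : ℝ), 0 ≤ M → (∀ x ∈ V', |f x| ≤ M) → ∃ g : X → ℝ, (∀ x ∈ V', g x = f x) ∧
    (∀ x ∈ V, |g x| ≤ M) ∧ QF V k g = QF V' k' f

theorem IsTr_one {X : Type*} (V : Finset X) (z : X) (hz : z ∉ V) (k : X → X → ℝ)
    (h0 : ∀ x y, 0 ≤ k x y) (hs : ∀ x y, k x y = k y x) :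
    ∃ k', IsTr V (insert z V) k' k := by
  set s := ∑ x ∈ V, k x z with hsd
  have hs0 : 0 ≤ s := Finset.sum_nonneg fun x _ => h0 _ _
  have key : ∀ g : X → ℝ, QF (insert z V) k g = QF V (fun x y => k x y + k x z * k y z / s) g
      + s * (g z - (∑ x ∈ V, k x z * g x) / s) ^ 2 := by
    intro g
    rw [QF_insert V z hz k hs, star_mesh V (fun x => k x z) g (fun x => h0 x z) (g z)]
    rw [← add_assoc]
    congr 1
    unfold QF
    rw [← mul_add, ← Finset.sum_add_distrib]
    congr 1
    refine Finset.sum_congr rfl fun x _ => ?_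
    rw [← Finset.sum_add_distrib]
    refine Finset.sum_congr rfl fun y _ => ?_
    ring
  refine ⟨fun x y => k x y + k x z * k y z / s, ?_, ?_, ?_, ?_⟩
  · intro x y
    have := h0 x y; have := h0 x z; have := h0 y z
    positivity
  · intro x y
    simp only [hs x y]; ring
  · intro g
    rw [key g]
    have : 0 ≤ s * (g z - (∑ x ∈ V, k x z * g x) / s) ^ 2 := by positivity
    linarith
  · intro f M hM hf
    have hg : ∀ x ∈ V, Function.update f z ((∑ x ∈ V, k x z * f x) / s) x = f x := by
      intro x hx
      rw [Function.update_of_ne]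
      rintro rfl; exact hz hx
    refine ⟨Function.update f z ((∑ x ∈ V, k x z * f x) / s), hg, ?_, ?_⟩
    · intro x hx
      rcases Finset.mem_insert.1 hx with rfl | hx
      · rw [Function.update_self, abs_div, abs_of_nonneg hs0]
        refine div_le_of_le_mul₀ hs0 hM ?_
        refine (Finset.abs_sum_le_sum_abs _ _).trans ?_
        rw [hsd, Finset.mul_sum]
        refine Finset.sum_le_sum fun y hy => ?_
        rw [abs_mul, abs_of_nonneg (h0 _ _), mul_comm]
        exact mul_le_mul_of_nonneg_right (hf y hy) (h0 _ _)
      · rw [hg x hx]; exact hf x hx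
    · rw [key, Function.update_self, QF_congr V _ _ f hg]
      have : ∑ x ∈ V, k x z * Function.update f z ((∑ x ∈ V, k x z * f x) / s) x
          = ∑ x ∈ V, k x z * f x := Finset.sum_congr rfl fun x hx => by rw [hg x hx]
      rw [this]; simp

theorem IsTr_exists {X : Type*} (V' : Finset X) (W : Finset X) :
    ∀ k : X → X → ℝ, (∀ x y, 0 ≤ k x y) → (∀ x y, k x y = k y x) →
    ∃ k', IsTr V' (V' ∪ W) k' k := by
  induction W using Finset.induction_on with
  | empty =>
    intro k h0 hs
    refine ⟨k, h0, hs, fun g => by simp, fun f M _ hf => ⟨f, fun _ _ => rfl, ?_, by simp⟩⟩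
    simpa using hf
  | insert z W hz ih =>
    intro k h0 hs
    by_cases hzV : z ∈ V' ∪ W
    · rw [Finset.union_insert, Finset.insert_eq_of_mem hzV]
      exact ih k h0 hs
    · obtain ⟨k1, a1, b1, c1, d1⟩ := IsTr_one (V' ∪ W) z hzV k h0 hs
      obtain ⟨k2, a2, b2, c2, d2⟩ := ih k1 a1 b1
      rw [Finset.union_insert]
      refine ⟨k2, a2, b2, fun g => (c2 g).trans (c1 g), ?_⟩
      intro f M hM hf
      obtain ⟨g, hg, hgM, he⟩ := d2 f M hM hf
      obtain ⟨g', hg', hgM', he'⟩ := d1 g M hM hgM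
      exact ⟨g', fun x hx => by rw [hg' x (Finset.mem_union_left _ hx), hg x hx], hgM',
        by rw [he', he]⟩

theorem ultra_lim (b : ℕ → ℝ) (M : ℝ) (n : ℕ) (h : ∀ l, n ≤ l → |b l| ≤ M) :
    ∃ x, Filter.Tendsto b (Filter.hyperfilter ℕ) (nhds x) := by
  have hc : IsCompact (Set.Icc (-M) M) := isCompact_Icc
  have hev : ∀ᶠ l in (Filter.hyperfilter ℕ : Filter ℕ), n ≤ l :=
    (Filter.eventually_ge_atTop n).filter_mono
      (by rw [← Nat.cofinite_eq_atTop]; exact Filter.hyperfilter_le_cofinite)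
  have : Set.Icc (-M) M ∈ (Filter.hyperfilter ℕ).map b := by
    rw [Ultrafilter.mem_map]
    filter_upwards [hev] with l hl
    exact abs_le.1 (h l hl)
  obtain ⟨x, _, hx⟩ := hc.ultrafilter_le_nhds' _ this
  exact ⟨x, hx⟩

theorem abstract_main {X : Type*} (V : ℕ → Finset X) (hV : ∀ n m, n ≤ m → V n ⊆ V m)
    (a : ℕ → X → X → ℝ) (h0 : ∀ n x y, 0 ≤ a n x y) (hs : ∀ n x y, a n x y = a n y x)
    (c : ℝ) (hc : 1 ≤ c)
    (hlow : ∀ n m, n ≤ m → ∀ g, QF (V n) (a n) g ≤ c * QF (V m) (a m) g)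
    (hup : ∀ n m, n ≤ m → ∀ f, ∃ g, (∀ x ∈ V n, g x = f x) ∧
      QF (V m) (a m) g ≤ c * QF (V n) (a n) f) :
    ∃ κ : ℕ → X → X → ℝ, (∀ n x y, 0 ≤ κ n x y) ∧ (∀ n x y, κ n x y = κ n y x) ∧
      (∀ n f, c⁻¹ * QF (V n) (a n) f ≤ QF (V n) (κ n) f ∧
        QF (V n) (κ n) f ≤ c * QF (V n) (a n) f) ∧
      (∀ n m, n ≤ m → ∀ f, QF (V n) (κ n) f = sInf {e : ℝ | ∃ g : X → ℝ,
          (∀ x ∈ V n, g x = f x) ∧ e = QF (V m) (κ m) g}) := by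
  have c0 : 0 < c := by linarith
  have hT : ∀ n l, ∃ k', n ≤ l → IsTr (V n) (V l) k' (a l) := by
    intro n l
    by_cases h : n ≤ l
    · obtain ⟨k', hk⟩ := IsTr_exists (V n) (V l) (a l) (h0 l) (hs l)
      rw [Finset.union_eq_right.2 (hV n l h)] at hk
      exact ⟨k', fun _ => hk⟩
    · exact ⟨0, fun h' => absurd h' h⟩
  choose T1 hT1 using hT
  set T : ℕ → ℕ → X → X → ℝ := fun n l x y =>
    if n ≤ l ∧ x ∈ V n ∧ y ∈ V n ∧ x ≠ y then T1 n l x y else 0 with hTdef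
  have T0 : ∀ n l x y, 0 ≤ T n l x y := by
    intro n l x y
    simp only [hTdef]
    split_ifs with h
    · exact (hT1 n l h.1).1 x y
    · exact le_rfl
  have Ts : ∀ n l x y, T n l x y = T n l y x := by
    intro n l x y
    simp only [hTdef]
    by_cases h : n ≤ l ∧ x ∈ V n ∧ y ∈ V n ∧ x ≠ y
    · rw [if_pos h, if_pos ⟨h.1, h.2.2.1, h.2.1, h.2.2.2.symm⟩]
      exact (hT1 n l h.1).2.1 x y
    · rw [if_neg h, if_neg]
      rintro ⟨a, b, c, d⟩
      exact h ⟨a, c, b, d.symm⟩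
  have TQ : ∀ n l, n ≤ l → ∀ f, QF (V n) (T n l) f = QF (V n) (T1 n l) f := by
    intro n l h f
    unfold QF
    congr 1
    refine Finset.sum_congr rfl fun x hx => Finset.sum_congr rfl fun y hy => ?_
    simp only [hTdef]
    by_cases hxy : x = y
    · subst hxy; simp
    · rw [if_pos ⟨h, hx, hy, hxy⟩]
  have Tle : ∀ n l, n ≤ l → ∀ g, QF (V n) (T n l) g ≤ QF (V l) (a l) g := fun n l h g => by
    rw [TQ n l h]; exact (hT1 n l h).2.2.1 g
  have Tex : ∀ n l, n ≤ l → ∀ (f : X → ℝ) (M : ℝ), 0 ≤ M → (∀ x ∈ V n, |f x| ≤ M) →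
      ∃ g : X → ℝ, (∀ x ∈ V n, g x = f x) ∧
      (∀ x ∈ V l, |g x| ≤ M) ∧ QF (V l) (a l) g = QF (V n) (T n l) f := by
    intro n l h
    simp_rw [TQ n l h]; exact (hT1 n l h).2.2.2
  have bd : ∀ n (f : X → ℝ), ∃ M, 0 ≤ M ∧ ∀ x ∈ V n, |f x| ≤ M := by
    intro n f
    exact ⟨∑ x ∈ V n, |f x|, Finset.sum_nonneg fun _ _ => abs_nonneg _,
      fun x hx => Finset.single_le_sum (f := fun x => |f x|) (fun _ _ => abs_nonneg _) hx⟩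
  have Tup : ∀ n l, n ≤ l → ∀ f, QF (V n) (T n l) f ≤ c * QF (V n) (a n) f := by
    intro n l h f
    obtain ⟨g, hg, hge⟩ := hup n l h f
    rw [← QF_congr (V n) (T n l) g f hg]
    exact (Tle n l h g).trans hge
  have Tlow : ∀ n l, n ≤ l → ∀ f, QF (V n) (a n) f ≤ c * QF (V n) (T n l) f := by
    intro n l h f
    obtain ⟨M, hM, hfM⟩ := bd n f
    obtain ⟨g, hg, -, hge⟩ := Tex n l h f M hM hfM
    rw [← hge, ← QF_congr (V n) (a n) g f hg]
    exact hlow n l h g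
  have Tb : ∀ n x y, ∃ M, ∀ l, n ≤ l → |T n l x y| ≤ M := by
    intro n x y
    refine ⟨2 * (c * QF (V n) (a n) (Pi.single x 1)), fun l hl => ?_⟩
    rw [abs_of_nonneg (T0 _ _ _ _)]
    have h2 : 0 ≤ QF (V n) (T n l) (Pi.single x 1) := by
      unfold QF
      refine mul_nonneg (by norm_num) (Finset.sum_nonneg fun x _ => Finset.sum_nonneg fun y _ =>
        mul_nonneg (T0 _ _ _ _) (sq_nonneg _))
    have hu := Tup n l hl (Pi.single x 1)
    by_cases h : n ≤ l ∧ x ∈ V n ∧ y ∈ V n ∧ x ≠ y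
    · have : T n l x y ≤ 2 * QF (V n) (T n l) (Pi.single x 1) := by
        unfold QF
        rw [← mul_assoc]
        norm_num
        have e1 : T n l x y * ((Pi.single x 1 : X → ℝ) x - (Pi.single x 1 : X → ℝ) y) ^ 2
            = T n l x y := by
          rw [Pi.single_eq_same, Pi.single_eq_of_ne h.2.2.2.symm]; ring
        rw [← e1]
        refine le_trans ?_ (Finset.single_le_sum (f := fun x' => ∑ y ∈ V n, T n l x' y *
          ((Pi.single x 1 : X → ℝ) x' - (Pi.single x 1 : X → ℝ) y) ^ 2)
          (fun x _ => Finset.sum_nonneg fun y _ => mul_nonneg (T0 _ _ _ _) (sq_nonneg _)) h.2.1)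
        exact Finset.single_le_sum (f := fun y' => T n l x y' *
          ((Pi.single x 1 : X → ℝ) x - (Pi.single x 1 : X → ℝ) y') ^ 2)
          (fun y _ => mul_nonneg (T0 _ _ _ _) (sq_nonneg _)) h.2.2.1
      linarith
    · have : T n l x y = 0 := by simp only [hTdef]; rw [if_neg h]
      rw [this]; linarith
  have hlim : ∀ n x y, ∃ k, Filter.Tendsto (fun l => T n l x y) (Filter.hyperfilter ℕ)
      (nhds k) := by
    intro n x y
    obtain ⟨M, hM⟩ := Tb n x y
    exact ultra_lim _ M n hM
  choose κ hκ using hlim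
  have hev : ∀ n, ∀ᶠ l in (Filter.hyperfilter ℕ : Filter ℕ), n ≤ l := fun n =>
    (Filter.eventually_ge_atTop n).filter_mono
      (by rw [← Nat.cofinite_eq_atTop]; exact Filter.hyperfilter_le_cofinite)
  have QFlim : ∀ n (fl : ℕ → X → ℝ) (f : X → ℝ),
      (∀ x ∈ V n, Filter.Tendsto (fun l => fl l x) (Filter.hyperfilter ℕ) (nhds (f x))) →
      Filter.Tendsto (fun l => QF (V n) (T n l) (fl l)) (Filter.hyperfilter ℕ)
        (nhds (QF (V n) (κ n) f)) := by
    intro n fl f hf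
    unfold QF
    refine Filter.Tendsto.const_mul _ ?_
    refine tendsto_finsetSum _ fun x hx => tendsto_finsetSum _ fun y hy => ?_
    exact (hκ n x y).mul (((hf x hx).sub (hf y hy)).pow 2)
  have QFlim' : ∀ n (f : X → ℝ), Filter.Tendsto (fun l => QF (V n) (T n l) f)
      (Filter.hyperfilter ℕ) (nhds (QF (V n) (κ n) f)) := fun n f =>
    QFlim n (fun _ => f) f fun x _ => tendsto_const_nhds
  refine ⟨κ, ?_, ?_, ?_, ?_⟩
  · intro n x y
    exact ge_of_tendsto' (hκ n x y) fun l => T0 _ _ _ _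
  · intro n x y
    refine tendsto_nhds_unique (hκ n x y) ?_
    simp_rw [Ts n _ x y]
    exact hκ n y x
  · intro n f
    constructor
    · refine ge_of_tendsto (QFlim' n f) ?_
      filter_upwards [hev n] with l hl
      rw [inv_mul_le_iff₀ c0]
      exact Tlow n l hl f
    · refine le_of_tendsto (QFlim' n f) ?_
      filter_upwards [hev n] with l hl
      exact Tup n l hl f
  · intro n m hnm f
    have mono : ∀ g : X → ℝ, (∀ x ∈ V n, g x = f x) →
        QF (V n) (κ n) f ≤ QF (V m) (κ m) g := by
      intro g hg
      refine le_of_tendsto_of_tendsto (QFlim' n f) (QFlim' m g) ?_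
      filter_upwards [hev m] with l hl
      obtain ⟨M, hM, hgM⟩ := bd m g
      obtain ⟨g', hg', -, he⟩ := Tex m l hl g M hM hgM
      rw [← he, ← QF_congr (V n) (T n l) g' f
        (fun x hx => by rw [hg' x (hV n m hnm hx), hg x hx])]
      exact Tle n l (hnm.trans hl) g'
    obtain ⟨M, hM, hfM⟩ := bd n f
    have hex : ∀ l, ∃ g : X → ℝ, n ≤ l → (∀ x ∈ V n, g x = f x) ∧
      (∀ x ∈ V l, |g x| ≤ M) ∧ QF (V l) (a l) g = QF (V n) (T n l) f := by
      intro l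
      by_cases h : n ≤ l
      · obtain ⟨g, hg⟩ := Tex n l h f M hM hfM
        exact ⟨g, fun _ => hg⟩
      · exact ⟨0, fun h' => absurd h' h⟩
    choose h hh using hex
    have hlg : ∀ x, ∃ g, x ∈ V m →
        Filter.Tendsto (fun l => h l x) (Filter.hyperfilter ℕ) (nhds g) := by
      intro x
      by_cases hx : x ∈ V m
      · obtain ⟨g, hg⟩ := ultra_lim (fun l => h l x) M m
          (fun l hl => (hh l (hnm.trans hl)).2.1 x (hV m l hl hx))
        exact ⟨g, fun _ => hg⟩
      · exact ⟨0, fun h' => absurd h' hx⟩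
    choose g hg using hlg
    have hgf : ∀ x ∈ V n, g x = f x := by
      intro x hx
      refine tendsto_nhds_unique (hg x (hV n m hnm hx)) ?_
      refine Filter.Tendsto.congr' ?_ tendsto_const_nhds
      filter_upwards [hev n] with l hl
      exact ((hh l hl).1 x hx).symm
    have hle : QF (V m) (κ m) g ≤ QF (V n) (κ n) f := by
      refine le_of_tendsto_of_tendsto (QFlim m h g fun x hx => hg x hx) (QFlim' n f) ?_
      filter_upwards [hev m] with l hl
      rw [← (hh l (hnm.trans hl)).2.2]
      exact Tle m l hl (h l)
    symm
    refine IsLeast.csInf_eq ⟨⟨g, hgf, le_antisymm (mono g hgf) hle⟩, ?_⟩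
    rintro e ⟨g', hg', rfl⟩
    exact (mono g' hg').trans (le_refl _)

/-- self-similar cell energy -/
noncomputable def En (L : ℕ) (A : Finset (ℕ × ℕ)) : ℕ → (ℝ × ℝ → ℝ) → ℝ
  | 0, f => (f (0, 0) - f (1, 0)) ^ 2 + (f (1, 0) - f (1, 1)) ^ 2 + (f (1, 1) - f (0, 1)) ^ 2
      + (f (0, 1) - f (0, 0)) ^ 2
  | n + 1, f => ∑ a ∈ A, En L A n (f ∘ Psi L a)

theorem En_nonneg (L : ℕ) (A : Finset (ℕ × ℕ)) (n : ℕ) : ∀ f, 0 ≤ En L A n f := by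
  induction n with
  | zero => intro f; simp only [En]; positivity
  | succ n ih => intro f; simp only [En]; exact Finset.sum_nonneg fun a _ => ih _

/-- lattice points of level `k` -/
def Lat (L k : ℕ) (z : ℝ × ℝ) : Prop :=
  ∃ i j : ℕ, i ≤ L ^ k ∧ j ≤ L ^ k ∧ z = ((i : ℝ) / (L : ℝ) ^ k, (j : ℝ) / (L : ℝ) ^ k)

theorem Lat_Psi (L : ℕ) (hL : 0 < L) (k : ℕ) (a : ℕ × ℕ) (ha : a.1 < L ∧ a.2 < L) (z : ℝ × ℝ)
    (hz : Lat L k z) : Lat L (k + 1) (Psi L a z) := by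
  obtain ⟨i, j, hi, hj, rfl⟩ := hz
  have hL' : (L : ℝ) ≠ 0 := by positivity
  have aux : ∀ i a : ℕ, i ≤ L ^ k → a < L → i + a * L ^ k ≤ L ^ (k + 1) := by
    intro i a hi ha
    calc i + a * L ^ k ≤ L ^ k + a * L ^ k := by omega
      _ = (a + 1) * L ^ k := by ring
      _ ≤ L * L ^ k := Nat.mul_le_mul_right _ ha
      _ = L ^ (k + 1) := by ring
  refine ⟨i + a.1 * L ^ k, j + a.2 * L ^ k, aux _ _ hi ha.1, aux _ _ hj ha.2, ?_⟩
  simp only [Psi, Prod.mk.injEq]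
  push_cast
  constructor <;> (field_simp; ring)

theorem Lat_zero (L k : ℕ) : Lat L k (0, 0) := ⟨0, 0, by simp, by simp, by simp⟩

theorem Lat_corner (L : ℕ) (hL : 0 < L) (k : ℕ) : Lat L k (1, 0) := by
  have hL' : (L : ℝ) ≠ 0 := by positivity
  exact ⟨L ^ k, 0, le_rfl, by simp, by simp [hL']⟩

theorem En_congr {L : ℕ} {A : Finset (ℕ × ℕ)} (h : GoodCarpet L A) (k : ℕ) :
    ∀ f g : ℝ × ℝ → ℝ, (∀ z, Lat L k z → f z = g z) → En L A k f = En L A k g := by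
  have hL : 0 < L := by have := h.three_le; omega
  induction k with
  | zero =>
    intro f g hfg
    have h1 : Lat L 0 (0, 0) := ⟨0, 0, by simp, by simp, by simp⟩
    have h2 : Lat L 0 (1, 0) := ⟨1, 0, by simp, by simp, by simp⟩
    have h3 : Lat L 0 (1, 1) := ⟨1, 1, by simp, by simp, by simp⟩
    have h4 : Lat L 0 (0, 1) := ⟨0, 1, by simp, by simp, by simp⟩
    simp only [En, hfg _ h1, hfg _ h2, hfg _ h3, hfg _ h4]
  | succ k ih =>
    intro f g hfg
    simp only [En]
    refine Finset.sum_congr rfl fun a ha => ih _ _ fun z hz => ?_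
    exact hfg _ (Lat_Psi L hL k a (h.mem_lt a ha) z hz)

theorem En_dom {ι : Type*} (L : ℕ) (A : Finset (ℕ × ℕ)) (s : Finset ι) (c : ℝ) (k : ℕ) :
    ∀ (F : ℝ × ℝ → ℝ) (u : ι → ℝ × ℝ → ℝ),
    (∀ z z', (F z - F z') ^ 2 ≤ c * ∑ i ∈ s, (u i z - u i z') ^ 2) →
    En L A k F ≤ c * ∑ i ∈ s, En L A k (u i) := by
  induction k with
  | zero =>
    intro F u h
    simp only [En, Finset.sum_add_distrib]
    have h1 := h (0, 0) (1, 0)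
    have h2 := h (1, 0) (1, 1)
    have h3 := h (1, 1) (0, 1)
    have h4 := h (0, 1) (0, 0)
    linarith
  | succ k ih =>
    intro F u h
    simp only [En]
    rw [Finset.sum_comm, Finset.mul_sum]
    exact Finset.sum_le_sum fun a _ => ih _ (fun i => u i ∘ Psi L a) fun z z' => h _ _

theorem En_dom1 (L : ℕ) (A : Finset (ℕ × ℕ)) (c : ℝ) (k : ℕ)
    (F u : ℝ × ℝ → ℝ) (h : ∀ z z', (F z - F z') ^ 2 ≤ c * (u z - u z') ^ 2) :
    En L A k F ≤ c * En L A k u := by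
  have := En_dom L A {()} c k F (fun _ => u) (by simpa using h)
  simpa using this

theorem En_dom2 (L : ℕ) (A : Finset (ℕ × ℕ)) (c : ℝ) (k : ℕ)
    (F u v : ℝ × ℝ → ℝ)
    (h : ∀ z z', (F z - F z') ^ 2 ≤ c * ((u z - u z') ^ 2 + (v z - v z') ^ 2)) :
    En L A k F ≤ c * (En L A k u + En L A k v) := by
  have := En_dom L A (Finset.univ : Finset Bool) c k F (fun b => if b then u else v)
    (by simpa using h)
  simpa using this

/-- reflection in the first coordinate -/
def rx (z : ℝ × ℝ) : ℝ × ℝ := (1 - z.1, z.2)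
/-- reflection in the second coordinate -/
def ry (z : ℝ × ℝ) : ℝ × ℝ := (z.1, 1 - z.2)

theorem En_swap {L : ℕ} {A : Finset (ℕ × ℕ)} (h : GoodCarpet L A) (k : ℕ) :
    ∀ f, En L A k (f ∘ Prod.swap) = En L A k f := by
  induction k with
  | zero => intro f; simp only [En, Function.comp, Prod.swap]; ring
  | succ k ih =>
    intro f
    simp only [En]
    refine Finset.sum_bij (fun a _ => a.swap) (fun a ha => h.symm_swap a.1 a.2 ha)
      (fun a _ b _ hab => Prod.swap_injective hab)
      (fun b hb => ⟨b.swap, h.symm_swap b.1 b.2 hb, by simp⟩) ?_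
    intro a _
    rw [← ih (f ∘ Psi L a.swap)]
    rfl

theorem En_rx {L : ℕ} {A : Finset (ℕ × ℕ)} (h : GoodCarpet L A) (k : ℕ) :
    ∀ f, En L A k (f ∘ rx) = En L A k f := by
  have hL : 0 < L := by have := h.three_le; omega
  have hL' : (L : ℝ) ≠ 0 := by positivity
  induction k with
  | zero => intro f; simp only [En, Function.comp, rx]; norm_num; ring
  | succ k ih =>
    intro f
    simp only [En]
    refine Finset.sum_bij (fun a _ => (L - 1 - a.1, a.2))
      (fun a ha => h.symm_reflect a.1 a.2 ha) ?_ ?_ ?_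
    · intro a ha b hb hab
      have h1 := (h.mem_lt a ha).1
      have h2 := (h.mem_lt b hb).1
      simp only [Prod.mk.injEq] at hab
      ext
      · omega
      · exact hab.2
    · intro b hb
      have h2 := (h.mem_lt b hb).1
      refine ⟨(L - 1 - b.1, b.2), h.symm_reflect b.1 b.2 hb, ?_⟩
      ext
      · simp only; omega
      · rfl
    · intro a ha
      have h1 := (h.mem_lt a ha).1
      rw [← ih (f ∘ Psi L (L - 1 - a.1, a.2))]
      congr 1
      funext z
      simp only [Function.comp, rx, Psi]
      congr 2
      have : ((L - 1 - a.1 : ℕ) : ℝ) = (L : ℝ) - 1 - a.1 := by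
        rw [Nat.cast_sub (by omega), Nat.cast_sub (by omega)]; simp
      rw [this]
      field_simp
      ring

theorem En_ry {L : ℕ} {A : Finset (ℕ × ℕ)} (h : GoodCarpet L A) (k : ℕ) (f) :
    En L A k (f ∘ ry) = En L A k f := by
  have : f ∘ ry = ((f ∘ Prod.swap) ∘ rx) ∘ Prod.swap := by
    funext z; simp [Function.comp, rx, ry, Prod.swap]
  rw [this, En_swap h, En_rx h, En_swap h]

/-- corner energy -/
noncomputable def qK (L : ℕ) (A : Finset (ℕ × ℕ)) (k : ℕ) : ℝ :=
  sInf {e | ∃ f : ℝ × ℝ → ℝ, f (0, 0) = 1 ∧ f (1, 0) = 0 ∧ e = En L A k f}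

theorem qK_le' (L : ℕ) (A : Finset (ℕ × ℕ)) (k : ℕ) (f : ℝ × ℝ → ℝ) (h0 : f (0, 0) = 1)
    (h1 : f (1, 0) = 0) : qK L A k ≤ En L A k f :=
  csInf_le ⟨0, by rintro e ⟨f, -, -, rfl⟩; exact En_nonneg _ _ _ _⟩ ⟨f, h0, h1, rfl⟩

theorem qK_nonempty (L : ℕ) (A : Finset (ℕ × ℕ)) (k : ℕ) :
    {e | ∃ f : ℝ × ℝ → ℝ, f (0, 0) = 1 ∧ f (1, 0) = 0 ∧ e = En L A k f}.Nonempty :=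
  ⟨_, fun z => 1 - z.1, by simp, by simp, rfl⟩

theorem le_qK (L : ℕ) (A : Finset (ℕ × ℕ)) (k : ℕ) (c : ℝ)
    (h : ∀ f : ℝ × ℝ → ℝ, f (0, 0) = 1 → f (1, 0) = 0 → c ≤ En L A k f) : c ≤ qK L A k :=
  le_csInf (qK_nonempty L A k) (by rintro e ⟨f, a, b, rfl⟩; exact h f a b)

theorem qK_le (L : ℕ) (A : Finset (ℕ × ℕ)) (k : ℕ) (f : ℝ × ℝ → ℝ) :
    qK L A k * (f (0, 0) - f (1, 0)) ^ 2 ≤ En L A k f := by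
  by_cases hd : f (0, 0) - f (1, 0) = 0
  · rw [hd]; simpa using En_nonneg L A k f
  · have h1 := qK_le' L A k (fun z => (f z - f (1, 0)) / (f (0, 0) - f (1, 0)))
      (div_self hd) (by simp)
    have h2 := En_dom1 L A (1 / (f (0, 0) - f (1, 0)) ^ 2) k
      (fun z => (f z - f (1, 0)) / (f (0, 0) - f (1, 0))) f (by
        intro z z'
        apply le_of_eq
        field_simp
        ring)
    have h3 := h1.trans h2
    have : 0 < (f (0, 0) - f (1, 0)) ^ 2 := by positivity
    rw [one_div, inv_mul_eq_div, le_div_iff₀ this] at h3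
    exact h3

theorem qK_restrict0 {L : ℕ} {A : Finset (ℕ × ℕ)} (h : GoodCarpet L A) (k : ℕ) (f) :
    qK L A k * En L A 0 f ≤ 4 * En L A k f := by
  have h1 := qK_le L A k f
  have h2 := qK_le L A k (f ∘ ry)
  have h3 := qK_le L A k (f ∘ Prod.swap)
  have h4 := qK_le L A k ((f ∘ rx) ∘ Prod.swap)
  rw [En_ry h] at h2
  rw [En_swap h] at h3
  rw [En_swap h, En_rx h] at h4
  simp only [Function.comp, ry, rx, Prod.swap, sub_zero] at h2 h3 h4
  simp only [En]
  nlinarith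

theorem qK_restrict {L : ℕ} {A : Finset (ℕ × ℕ)} (h : GoodCarpet L A) (k n : ℕ) :
    ∀ f, qK L A k * En L A n f ≤ 4 * En L A (k + n) f := by
  induction n with
  | zero => exact qK_restrict0 h k
  | succ n ih =>
    intro f
    rw [← Nat.add_assoc]
    simp only [En]
    rw [Finset.mul_sum, Finset.mul_sum]
    exact Finset.sum_le_sum fun a _ => ih _

/-- sum over the bottom row -/
noncomputable def rowG (L : ℕ) (f : ℝ × ℝ → ℝ) : ℝ × ℝ → ℝ := fun z =>
  ∑ i ∈ Finset.range L, f (Psi L (i, 0) z)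

theorem rowG_diff (L : ℕ) (hL : 0 < L) (f : ℝ × ℝ → ℝ) (y : ℝ) :
    rowG L f (1, y) - rowG L f (0, y) = f (1, y / L) - f (0, y / L) := by
  have hL' : (L : ℝ) ≠ 0 := by positivity
  unfold rowG
  rw [← Finset.sum_sub_distrib]
  have := Finset.sum_range_sub (fun i : ℕ => f ((i : ℝ) / L, y / L)) L
  simp only [Nat.cast_zero, zero_div, div_self hL'] at this
  rw [← this]
  refine Finset.sum_congr rfl fun i _ => ?_
  simp only [Psi]
  push_cast
  simp [add_comm]

theorem rowG_En {L : ℕ} {A : Finset (ℕ × ℕ)} (h : GoodCarpet L A) (m : ℕ) (f) :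
    En L A m (rowG L f) ≤ L * En L A (m + 1) f := by
  have hL : 0 < L := by have := h.three_le; omega
  have h1 := En_dom L A (Finset.range L) L m (rowG L f) (fun i => f ∘ Psi L (i, 0)) (by
    intro z z'
    unfold rowG
    rw [← Finset.sum_sub_distrib]
    have := @sq_sum_le_card_mul_sum_sq ℕ ℝ _ _ _ _ (Finset.range L)
      (fun i => f (Psi L (i, 0) z) - f (Psi L (i, 0) z'))
    simpa using this)
  refine h1.trans ?_
  refine mul_le_mul_of_nonneg_left ?_ (by positivity)
  simp only [En]
  have : ∑ i ∈ Finset.range L, En L A m (f ∘ Psi L (i, 0))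
      = ∑ a ∈ (Finset.range L).image (fun i => (i, 0)), En L A m (f ∘ Psi L a) := by
    rw [Finset.sum_image]
    intro a _ b _ hab
    simpa using hab
  rw [this]
  refine Finset.sum_le_sum_of_subset_of_nonneg ?_ fun a _ _ => En_nonneg _ _ _ _
  intro a ha
  simp only [Finset.mem_image, Finset.mem_range] at ha
  obtain ⟨i, hi, rfl⟩ := ha
  exact h.flat_border i 0 hi hL (by simp)

theorem rowG_iter_En {L : ℕ} {A : Finset (ℕ × ℕ)} (h : GoodCarpet L A) (m n : ℕ) :
    ∀ f, En L A m ((rowG L)^[n] f) ≤ (L : ℝ) ^ n * En L A (m + n) f := by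
  induction n with
  | zero => intro f; simp
  | succ n ih =>
    intro f
    rw [Function.iterate_succ, Function.comp]
    refine (ih _).trans ?_
    have := rowG_En h (m + n) f
    rw [pow_succ, mul_assoc]
    exact mul_le_mul_of_nonneg_left this (by positivity)

theorem rowG_iter_diff (L : ℕ) (hL : 0 < L) (n : ℕ) : ∀ (f : ℝ × ℝ → ℝ) (y : ℝ),
    (rowG L)^[n] f (1, y) - (rowG L)^[n] f (0, y) = f (1, y / (L : ℝ) ^ n)
      - f (0, y / (L : ℝ) ^ n) := by
  induction n with
  | zero => intro f y; simp
  | succ n ih =>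
    intro f y
    rw [Function.iterate_succ, Function.comp, ih, rowG_diff L hL, div_div, ← pow_succ]

theorem qK_pos {L : ℕ} {A : Finset (ℕ × ℕ)} (h : GoodCarpet L A) (n : ℕ) : 0 < qK L A n := by
  have hL : 0 < L := by have := h.three_le; omega
  have : 0 < ((L : ℝ) ^ n)⁻¹ := by positivity
  refine lt_of_lt_of_le this (le_qK L A n _ fun f h0 h1 => ?_)
  have h2 := rowG_iter_En h 0 n f
  have h3 := rowG_iter_diff L hL n f 0
  rw [zero_div, h0, h1] at h3
  rw [zero_add] at h2
  rw [inv_le_iff_one_le_mul₀ (by positivity), mul_comm]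
  refine le_trans ?_ h2
  simp only [En]
  have : ((rowG L)^[n] f (0, 0) - (rowG L)^[n] f (1, 0)) ^ 2 = 1 := by
    have : (rowG L)^[n] f (0, 0) - (rowG L)^[n] f (1, 0) = 1 := by linarith
    rw [this]; norm_num
  rw [this]
  nlinarith [sq_nonneg ((rowG L)^[n] f (1, 0) - (rowG L)^[n] f (1, 1)),
    sq_nonneg ((rowG L)^[n] f (1, 1) - (rowG L)^[n] f (0, 1)),
    sq_nonneg ((rowG L)^[n] f (0, 1) - (rowG L)^[n] f (0, 0))]


/-- bilinear interpolation -/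
noncomputable def bil (u f : ℝ × ℝ → ℝ) (z : ℝ × ℝ) : ℝ :=
  (1 - u z) * (1 - u z.swap) * f (0, 0) + u z * (1 - u z.swap) * f (1, 0)
    + (1 - u z) * u z.swap * f (0, 1) + u z * u z.swap * f (1, 1)

/-- bilinear interpolation on the cells of size `1/N` -/
noncomputable def ext (u : ℝ × ℝ → ℝ) (N : ℕ) (f : ℝ × ℝ → ℝ) (z : ℝ × ℝ) : ℝ :=
  (1 - u (Int.fract (N * z.1), Int.fract (N * z.2)))
      * (1 - u (Int.fract (N * z.2), Int.fract (N * z.1)))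
      * f ((⌊N * z.1⌋ : ℝ) / N, (⌊N * z.2⌋ : ℝ) / N)
    + u (Int.fract (N * z.1), Int.fract (N * z.2))
      * (1 - u (Int.fract (N * z.2), Int.fract (N * z.1)))
      * f (((⌊N * z.1⌋ : ℝ) + 1) / N, (⌊N * z.2⌋ : ℝ) / N)
    + (1 - u (Int.fract (N * z.1), Int.fract (N * z.2)))
      * u (Int.fract (N * z.2), Int.fract (N * z.1))
      * f ((⌊N * z.1⌋ : ℝ) / N, ((⌊N * z.2⌋ : ℝ) + 1) / N)
    + u (Int.fract (N * z.1), Int.fract (N * z.2))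
      * u (Int.fract (N * z.2), Int.fract (N * z.1))
      * f (((⌊N * z.1⌋ : ℝ) + 1) / N, ((⌊N * z.2⌋ : ℝ) + 1) / N)

theorem ext_comp (L : ℕ) (hL : 0 < L) (u : ℝ × ℝ → ℝ) (N : ℕ) (hN : 0 < N) (f : ℝ × ℝ → ℝ)
    (a : ℕ × ℕ) : ext u (N * L) f ∘ Psi L a = ext u N (f ∘ Psi L a) := by
  funext z
  have hL' : (L : ℝ) ≠ 0 := by positivity
  have hN' : (N : ℝ) ≠ 0 := by positivity
  have e : ∀ (x : ℝ) (b : ℕ), ((N * L : ℕ) : ℝ) * ((x + b) / L) = N * x + ((N * b : ℕ) : ℝ) := by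
    intro x b; push_cast; field_simp
  have e2 : ∀ (x : ℝ) (b : ℕ), (((⌊N * x⌋ + ((N * b : ℕ) : ℤ) : ℤ) : ℝ)) / ((N * L : ℕ) : ℝ)
      = ((⌊N * x⌋ : ℝ) / N + b) / L := by
    intro x b; push_cast; field_simp
  have e3 : ∀ (x : ℝ) (b : ℕ), (((⌊N * x⌋ + ((N * b : ℕ) : ℤ) : ℤ) : ℝ) + 1) / ((N * L : ℕ) : ℝ)
      = (((⌊N * x⌋ : ℝ) + 1) / N + b) / L := by
    intro x b; push_cast; field_simp; ring
  simp only [ext, Function.comp, Psi]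
  simp only [e, Int.fract_add_natCast, Int.floor_add_natCast, e2, e3]

theorem ext_lat (L : ℕ) (hL : 0 < L) (u : ℝ × ℝ → ℝ) (hu : u (0, 0) = 0) (n : ℕ)
    (f : ℝ × ℝ → ℝ) (z : ℝ × ℝ) (hz : Lat L n z) : ext u (L ^ n) f z = f z := by
  obtain ⟨i, j, -, -, rfl⟩ := hz
  have hL' : (L : ℝ) ≠ 0 := by positivity
  have e : ∀ i : ℕ, ((L ^ n : ℕ) : ℝ) * ((i : ℝ) / (L : ℝ) ^ n) = (i : ℝ) := by
    intro i; push_cast; field_simp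
  simp only [ext, e, Int.fract_natCast, Int.floor_natCast, hu]
  push_cast
  ring

/-- good profile -/
structure Good (u : ℝ × ℝ → ℝ) : Prop where
  nn : ∀ z, 0 ≤ u z
  le : ∀ z, u z ≤ 1
  left : ∀ y, u (0, y) = 0
  right : ∀ y, u (1, y) = 1
  per : ∀ x, u (x, 0) = u (x, 1)

theorem ext_one (u : ℝ × ℝ → ℝ) (hu : Good u) (f : ℝ × ℝ → ℝ) (x y : ℝ)
    (hx : 0 ≤ x ∧ x ≤ 1) (hy : 0 ≤ y ∧ y ≤ 1) : ext u 1 f (x, y) = bil u f (x, y) := by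
  have hf : ∀ x : ℝ, 0 ≤ x → x < 1 → ⌊x⌋ = 0 ∧ Int.fract x = x := by
    intro x h0 h1
    exact ⟨Int.floor_eq_zero_iff.2 ⟨h0, h1⟩, Int.fract_eq_self.2 ⟨h0, h1⟩⟩
  rcases lt_or_eq_of_le hx.2 with hx1 | rfl
  · rcases lt_or_eq_of_le hy.2 with hy1 | rfl
    · obtain ⟨a, b⟩ := hf x hx.1 hx1
      obtain ⟨c, d⟩ := hf y hy.1 hy1
      simp [ext, bil, a, b, c, d]
    · obtain ⟨a, b⟩ := hf x hx.1 hx1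
      simp [ext, bil, a, b, hu.left, hu.right, hu.per]
  · rcases lt_or_eq_of_le hy.2 with hy1 | rfl
    · obtain ⟨a, b⟩ := hf y hy.1 hy1
      simp [ext, bil, a, b, hu.left, hu.right, hu.per]
    · simp [ext, bil, hu.left, hu.right]

theorem conv_sq (t p q : ℝ) (h0 : 0 ≤ t) (h1 : t ≤ 1) :
    ((1 - t) * p + t * q) ^ 2 ≤ p ^ 2 + q ^ 2 := by
  have e : p ^ 2 + q ^ 2 - ((1 - t) * p + t * q) ^ 2
      = t * (1 - t) * (p - q) ^ 2 + t * p ^ 2 + (1 - t) * q ^ 2 := by ring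
  have h2 : 0 ≤ 1 - t := sub_nonneg.2 h1
  have : 0 ≤ t * (1 - t) * (p - q) ^ 2 + t * p ^ 2 + (1 - t) * q ^ 2 := by positivity
  linarith

theorem bil_pt (s t s' t' a b c d : ℝ) (ht0 : 0 ≤ t) (ht1 : t ≤ 1) (hs0 : 0 ≤ s')
    (hs1 : s' ≤ 1) :
    ((1 - s) * (1 - t) * a + s * (1 - t) * b + (1 - s) * t * d + s * t * c
      - ((1 - s') * (1 - t') * a + s' * (1 - t') * b + (1 - s') * t' * d + s' * t' * c)) ^ 2
    ≤ 2 * ((a - b) ^ 2 + (b - c) ^ 2 + (c - d) ^ 2 + (d - a) ^ 2)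
      * ((s - s') ^ 2 + (t - t') ^ 2) := by
  have c1 := conv_sq t (b - a) (c - d) ht0 ht1
  have c2 := conv_sq s' (d - a) (c - b) hs0 hs1
  have k1 : ((1 - t) * (b - a) + t * (c - d)) ^ 2 ≤
    (a - b) ^ 2 + (b - c) ^ 2 + (c - d) ^ 2 + (d - a) ^ 2 := by
    linarith [sq_nonneg (b - c), sq_nonneg (d - a), sub_sq_comm a b]
  have k2 : ((1 - s') * (d - a) + s' * (c - b)) ^ 2 ≤
    (a - b) ^ 2 + (b - c) ^ 2 + (c - d) ^ 2 + (d - a) ^ 2 := by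
    linarith [sq_nonneg (a - b), sq_nonneg (c - d), sub_sq_comm b c]
  have e : (1 - s) * (1 - t) * a + s * (1 - t) * b + (1 - s) * t * d + s * t * c
    - ((1 - s') * (1 - t') * a + s' * (1 - t') * b + (1 - s') * t' * d + s' * t' * c)
    = (s - s') * ((1 - t) * (b - a) + t * (c - d))
      + (t - t') * ((1 - s') * (d - a) + s' * (c - b)) := by ring
  rw [e]
  generalize (a - b) ^ 2 + (b - c) ^ 2 + (c - d) ^ 2 + (d - a) ^ 2 = Q at *
  generalize (1 - t) * (b - a) + t * (c - d) = P1 at *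
  generalize (1 - s') * (d - a) + s' * (c - b) = P2 at *
  have m1 := mul_le_mul_of_nonneg_left k1 (sq_nonneg (s - s'))
  have m2 := mul_le_mul_of_nonneg_left k2 (sq_nonneg (t - t'))
  have m3 := sq_nonneg ((s - s') * P1 - (t - t') * P2)
  linarith

theorem bil_En {L : ℕ} {A : Finset (ℕ × ℕ)} (h : GoodCarpet L A) (k : ℕ) (u : ℝ × ℝ → ℝ)
    (hu : Good u) (f : ℝ × ℝ → ℝ) :
    En L A k (bil u f) ≤ 4 * En L A k u * En L A 0 f := by
  have h1 := En_dom2 L A (2 * En L A 0 f) k (bil u f) u (u ∘ Prod.swap)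
    (fun z z' => bil_pt _ _ _ _ _ _ _ _ (hu.nn _) (hu.le _) (hu.nn _) (hu.le _))
  rw [En_swap h] at h1
  linarith

theorem ext_En {L : ℕ} {A : Finset (ℕ × ℕ)} (h : GoodCarpet L A) (k : ℕ) (u : ℝ × ℝ → ℝ)
    (hu : Good u) (n : ℕ) : ∀ f : ℝ × ℝ → ℝ,
    En L A (k + n) (ext u (L ^ n) f) ≤ 4 * En L A k u * En L A n f := by
  have hL : 0 < L := by have := h.three_le; omega
  have hL' : (0 : ℝ) < L := by positivity
  induction n with
  | zero =>
    intro f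
    rw [Nat.add_zero, pow_zero, En_congr h k (ext u 1 f) (bil u f)]
    · exact bil_En h k u hu f
    · rintro z ⟨i, j, hi, hj, rfl⟩
      have : ∀ i : ℕ, i ≤ L ^ k → 0 ≤ (i : ℝ) / (L : ℝ) ^ k ∧ (i : ℝ) / (L : ℝ) ^ k ≤ 1 := by
        intro i hi
        refine ⟨by positivity, ?_⟩
        rw [div_le_one (by positivity)]
        exact_mod_cast hi
      exact ext_one u hu f _ _ (this i hi) (this j hj)
  | succ n ih =>
    intro f
    rw [← Nat.add_assoc]
    simp only [En]
    rw [Finset.mul_sum]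
    refine Finset.sum_le_sum fun a _ => ?_
    rw [pow_succ, ext_comp L hL u _ (by positivity)]
    exact ih _

/-- crossing condition -/
def Cross (L k : ℕ) (f : ℝ × ℝ → ℝ) : Prop :=
  ∀ t : ℕ, t ≤ L ^ k → f (0, (t : ℝ) / (L : ℝ) ^ k) = 0 ∧ f (1, (t : ℝ) / (L : ℝ) ^ k) = 1

/-- crossing energy -/
noncomputable def eK (L : ℕ) (A : Finset (ℕ × ℕ)) (k : ℕ) : ℝ :=
  sInf {e | ∃ f : ℝ × ℝ → ℝ, Cross L k f ∧ e = En L A k f}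

theorem eK_le (L : ℕ) (A : Finset (ℕ × ℕ)) (k : ℕ) (f : ℝ × ℝ → ℝ) (h0 : Cross L k f) :
    eK L A k ≤ En L A k f :=
  csInf_le ⟨0, by rintro e ⟨f, -, rfl⟩; exact En_nonneg _ _ _ _⟩ ⟨f, h0, rfl⟩

theorem Cross_fst (L k : ℕ) : Cross L k Prod.fst := fun t _ => by simp

theorem qK_le_eK (L : ℕ) (A : Finset (ℕ × ℕ)) (k : ℕ) : qK L A k ≤ eK L A k := by
  refine le_csInf ⟨_, Prod.fst, Cross_fst L k, rfl⟩ ?_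
  rintro e ⟨f, hf, rfl⟩
  have := qK_le L A k f
  have h0 := hf 0 (Nat.zero_le _)
  simp only [Nat.cast_zero, zero_div] at h0
  rw [h0.1, h0.2] at this
  simpa using this

theorem clamp_sq (a b : ℝ) : (max 0 (min 1 a) - max 0 (min 1 b)) ^ 2 ≤ (a - b) ^ 2 := by
  rw [sq_le_sq]
  rw [max_comm 0, max_comm 0]
  refine (abs_max_sub_max_le_abs (min 1 a) (min 1 b) 0).trans ?_
  have := abs_min_sub_min_le_max 1 a 1 b
  simpa using this

theorem exists_good {L : ℕ} {A : Finset (ℕ × ℕ)} (h : GoodCarpet L A) (k : ℕ) :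
    ∃ u, Good u ∧ En L A k u ≤ 2 * eK L A k := by
  have hL : 0 < L := by have := h.three_le; omega
  have hL' : (0 : ℝ) < L := by positivity
  have he : 0 < eK L A k := (qK_pos h k).trans_le (qK_le_eK L A k)
  obtain ⟨e, ⟨f, hf, rfl⟩, hlt⟩ := exists_lt_of_csInf_lt
    (s := {e | ∃ f : ℝ × ℝ → ℝ, Cross L k f ∧ e = En L A k f})
    ⟨_, Prod.fst, Cross_fst L k, rfl⟩ (show eK L A k < 2 * eK L A k by linarith)
  set u1 : ℝ × ℝ → ℝ := fun z => max 0 (min 1 (f z)) with hu1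
  set u2 : ℝ × ℝ → ℝ := fun z => if z.1 = 0 then 0 else if z.1 = 1 then 1 else u1 z with hu2
  set u3 : ℝ × ℝ → ℝ := fun z => (u2 z + u2 (ry z)) / 2 with hu3
  have e1 : En L A k u1 ≤ En L A k f := by
    have := En_dom1 L A 1 k u1 f (fun z z' => by rw [one_mul]; exact clamp_sq _ _)
    linarith
  have e2 : En L A k u2 = En L A k u1 := by
    refine En_congr h k _ _ ?_
    rintro z ⟨i, j, hi, hj, rfl⟩
    obtain ⟨c0, c1⟩ := hf j hj
    simp only [hu2]
    split_ifs with a b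
    · rw [a, hu1]; simp only [c0]; norm_num
    · rw [b, hu1]; simp only [c1]; norm_num
    · rfl
  have e3 : En L A k u3 ≤ (1 / 2) * (En L A k u2 + En L A k (u2 ∘ ry)) := by
    refine En_dom2 L A _ k _ _ _ ?_
    intro z z'
    simp only [hu3, Function.comp]
    nlinarith [sq_nonneg ((u2 z - u2 z') - (u2 (ry z) - u2 (ry z')))]
  rw [En_ry h] at e3
  have n2 : ∀ z, 0 ≤ u2 z ∧ u2 z ≤ 1 := by
    intro z
    simp only [hu2]
    split_ifs
    · norm_num
    · norm_num
    · exact ⟨le_max_left _ _, max_le (by norm_num) (min_le_left _ _)⟩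
  refine ⟨u3, ⟨?_, ?_, ?_, ?_, ?_⟩, by linarith⟩
  · intro z; have := n2 z; have := n2 (ry z); simp only [hu3]; linarith
  · intro z; have := n2 z; have := n2 (ry z); simp only [hu3]; linarith
  · intro y; simp [hu3, hu2, ry]
  · intro y; simp [hu3, hu2, ry]
  · intro x; simp only [hu3, ry, sub_zero, sub_self]; rw [add_comm]

theorem extension {L : ℕ} {A : Finset (ℕ × ℕ)} (h : GoodCarpet L A) (k n : ℕ) (f : ℝ × ℝ → ℝ) :
    ∃ g : ℝ × ℝ → ℝ, (∀ z, Lat L n z → g z = f z) ∧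
      En L A (k + n) g ≤ 8 * eK L A k * En L A n f := by
  have hL : 0 < L := by have := h.three_le; omega
  obtain ⟨u, hu, hue⟩ := exists_good h k
  refine ⟨ext u (L ^ n) f, fun z hz => ext_lat L hL u (hu.left 0) n f z hz, ?_⟩
  refine (ext_En h k u hu n f).trans ?_
  have := mul_le_mul_of_nonneg_right hue (En_nonneg L A n f)
  linarith

theorem qK_mul {L : ℕ} {A : Finset (ℕ × ℕ)} (h : GoodCarpet L A) (k n : ℕ) :
    qK L A (k + n) ≤ 8 * eK L A k * qK L A n := by
  have hL : 0 < L := by have := h.three_le; omega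
  have he : 0 < eK L A k := (qK_pos h k).trans_le (qK_le_eK L A k)
  rw [mul_comm, ← div_le_iff₀ (by positivity)]
  refine le_qK _ _ _ _ fun f h0 h1 => ?_
  obtain ⟨g, hg, hge⟩ := extension h k n f
  rw [div_le_iff₀ (by positivity), mul_comm]
  refine le_trans (qK_le' L A _ g ?_ ?_) hge
  · rw [hg _ (Lat_zero L n), h0]
  · rw [hg _ (Lat_corner L hL n), h1]

/-- the mass ratio -/
noncomputable def th (L : ℕ) (A : Finset (ℕ × ℕ)) : ℝ := (A.card : ℝ) / (L : ℝ) ^ 2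

theorem th_pos {L : ℕ} {A : Finset (ℕ × ℕ)} (h : GoodCarpet L A) : 0 < th L A := by
  have hL : 0 < L := by have := h.three_le; omega
  have : 0 < A.card := Finset.card_pos.2 ⟨_, h.flat_border 0 0 hL hL (by simp)⟩
  unfold th; positivity

theorem th_lt {L : ℕ} {A : Finset (ℕ × ℕ)} (h : GoodCarpet L A) : th L A < 1 := by
  have hL : 0 < L := by have := h.three_le; omega
  obtain ⟨a, b, ha, hb, hab⟩ := h.proper
  have : A ⊂ Finset.range L ×ˢ Finset.range L := by
    rw [Finset.ssubset_iff_of_subset]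
    · exact ⟨(a, b), by simp [ha, hb], hab⟩
    · intro p hp
      have := h.mem_lt p hp
      simp [this]
  have := Finset.card_lt_card this
  simp only [Finset.card_product, Finset.card_range] at this
  unfold th
  rw [div_lt_one (by positivity), pow_two]
  exact_mod_cast this

theorem En_fst {L : ℕ} {A : Finset (ℕ × ℕ)} (h : GoodCarpet L A) (n : ℕ) :
    En L A n Prod.fst ≤ 2 * th L A ^ n := by
  have hL : 0 < L := by have := h.three_le; omega
  induction n with
  | zero => simp [En]; norm_num
  | succ n ih =>
    simp only [En]
    have : ∀ a ∈ A, En L A n (Prod.fst ∘ Psi L a) ≤ (1 / (L : ℝ) ^ 2) * En L A n Prod.fst := by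
      intro a _
      refine En_dom1 L A _ n _ _ fun z z' => le_of_eq ?_
      simp only [Function.comp, Psi]
      field_simp
      ring
    refine (Finset.sum_le_sum this).trans ?_
    rw [Finset.sum_const, nsmul_eq_mul, ← mul_assoc]
    have e : (A.card : ℝ) * (1 / (L : ℝ) ^ 2) = th L A := by unfold th; ring
    rw [e, pow_succ]
    have := mul_le_mul_of_nonneg_left ih (th_pos h).le
    linarith

theorem eK_th {L : ℕ} {A : Finset (ℕ × ℕ)} (h : GoodCarpet L A) (n : ℕ) :
    eK L A n ≤ 2 * th L A ^ n := (eK_le L A n _ (Cross_fst L n)).trans (En_fst h n)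

theorem qK_th {L : ℕ} {A : Finset (ℕ × ℕ)} (h : GoodCarpet L A) (k n : ℕ) :
    qK L A (k + n) ≤ 16 * th L A ^ k * qK L A n := by
  refine (qK_mul h k n).trans ?_
  have := mul_le_mul_of_nonneg_right (eK_th h k) (qK_pos h n).le
  linarith


theorem En_sub {L : ℕ} {A : Finset (ℕ × ℕ)} (m : ℕ) (f : ℝ × ℝ → ℝ) (a : ℕ × ℕ) (ha : a ∈ A) :
    En L A m (f ∘ Psi L a) ≤ En L A (m + 1) f := by
  simp only [En]
  exact Finset.single_le_sum (f := fun a => En L A m (f ∘ Psi L a))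
    (fun _ _ => En_nonneg _ _ _ _) ha

theorem edge_le {L : ℕ} {A : Finset (ℕ × ℕ)} (h : GoodCarpet L A) (m : ℕ) (f : ℝ × ℝ → ℝ) :
    |f (0, 1) - f (0, 0)| ≤ 1 / √(qK L A m) * √(En L A m f) := by
  have h1 := qK_le L A m (f ∘ Prod.swap)
  have hq := qK_pos h m
  rw [En_swap h] at h1
  simp only [Function.comp, Prod.swap] at h1
  rw [one_div, ← Real.sqrt_inv, ← Real.sqrt_mul (by positivity), abs_sub_comm]
  refine Real.abs_le_sqrt ?_
  rw [inv_mul_eq_div, le_div_iff₀ hq, mul_comm]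
  exact h1

theorem col_le {L : ℕ} {A : Finset (ℕ × ℕ)} (h : GoodCarpet L A) (m : ℕ) (f : ℝ × ℝ → ℝ)
    (d : ℕ) (hd : d ≤ L) :
    |f (0, (d : ℝ) / L) - f (0, 0)| ≤ d * (1 / √(qK L A m) * √(En L A (m + 1) f)) := by
  have hL : 0 < L := by have := h.three_le; omega
  induction d with
  | zero => simp
  | succ d ih =>
    have h1 := ih (by omega)
    have h2 := edge_le h m (f ∘ Psi L (0, d))
    have h3 : √(En L A m (f ∘ Psi L (0, d))) ≤ √(En L A (m + 1) f) :=
      Real.sqrt_le_sqrt (En_sub m f _ (h.flat_border 0 d hL (by omega) (by simp)))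
    have h4 : |f (0, ((d + 1 : ℕ) : ℝ) / L) - f (0, (d : ℝ) / L)|
        ≤ 1 / √(qK L A m) * √(En L A (m + 1) f) := by
      refine le_trans ?_ (mul_le_mul_of_nonneg_left h3 (by positivity))
      refine le_trans (le_of_eq ?_) h2
      simp [Psi, add_comm]
    have h5 := abs_sub_le (f (0, ((d + 1 : ℕ) : ℝ) / L)) (f (0, (d : ℝ) / L)) (f (0, 0))
    push_cast at *
    linarith

theorem osc1 {L : ℕ} {A : Finset (ℕ × ℕ)} (h : GoodCarpet L A) (m : ℕ) :
    ∀ (f : ℝ × ℝ → ℝ) (t : ℕ), t ≤ L ^ m → |f (0, (t : ℝ) / (L : ℝ) ^ m) - f (0, 0)| ≤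
      (L * (1 / √(qK L A 0)) + ∑ i ∈ Finset.range m, L * (1 / √(qK L A i))) * √(En L A m f) := by
  have hL : 0 < L := by have := h.three_le; omega
  have hL1 : (1 : ℝ) ≤ L := by exact_mod_cast hL
  induction m with
  | zero =>
    intro f t ht
    have e := edge_le h 0 f
    have : 1 / √(qK L A 0) * √(En L A 0 f) ≤ L * (1 / √(qK L A 0) * √(En L A 0 f)) :=
      le_mul_of_one_le_left (by positivity) hL1
    simp only [pow_zero] at ht
    interval_cases t
    · simp; positivity
    · simp only [Nat.cast_one, pow_zero, div_one, Finset.range_zero, Finset.sum_empty, add_zero]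
      linarith
  | succ m ih =>
    intro f t ht
    rw [Finset.sum_range_succ]
    have nn : 0 ≤ L * (1 / √(qK L A 0)) + ∑ i ∈ Finset.range m, L * (1 / √(qK L A i)) := by
      have := Finset.sum_nonneg (s := Finset.range m) (f := fun i => L * (1 / √(qK L A i)))
        (fun i _ => by positivity)
      positivity
    set S := L * (1 / √(qK L A 0)) + ∑ i ∈ Finset.range m, L * (1 / √(qK L A i)) with hS
    rw [← add_assoc, ← hS, add_mul]
    rcases lt_or_eq_of_le ht with ht | ht
    · have hLm : 0 < L ^ m := by positivity
      have hd : t / L ^ m < L := by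
        rw [Nat.div_lt_iff_lt_mul hLm, mul_comm, ← pow_succ]; exact ht
      have h1 := col_le h m f (t / L ^ m) hd.le
      have h2 := ih (f ∘ Psi L (0, t / L ^ m)) (t % L ^ m) (Nat.mod_lt _ hLm).le
      have h3 : √(En L A m (f ∘ Psi L (0, t / L ^ m))) ≤ √(En L A (m + 1) f) :=
        Real.sqrt_le_sqrt (En_sub m f _ (h.flat_border 0 _ hL hd (by simp)))
      have h4 := h2.trans (mul_le_mul_of_nonneg_left h3 nn)
      have e1 : (f ∘ Psi L (0, t / L ^ m)) (0, ((t % L ^ m : ℕ) : ℝ) / (L : ℝ) ^ m)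
          = f (0, (t : ℝ) / (L : ℝ) ^ (m + 1)) := by
        have hd := Nat.div_add_mod t (L ^ m)
        have hd' : (t : ℝ) = (L : ℝ) ^ m * ((t / L ^ m : ℕ) : ℝ) + ((t % L ^ m : ℕ) : ℝ) := by
          exact_mod_cast hd.symm
        simp only [Function.comp, Psi]
        congr 2
        · simp
        · rw [hd', pow_succ]
          field_simp
          ring
      have e2 : (f ∘ Psi L (0, t / L ^ m)) (0, 0) = f (0, ((t / L ^ m : ℕ) : ℝ) / L) := by
        simp [Psi]
      rw [e1, e2] at h4
      have h5 := abs_sub_le (f (0, (t : ℝ) / (L : ℝ) ^ (m + 1)))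
        (f (0, ((t / L ^ m : ℕ) : ℝ) / L)) (f (0, 0))
      have h6 : ((t / L ^ m : ℕ) : ℝ) * (1 / √(qK L A m) * √(En L A (m + 1) f)) ≤
          L * (1 / √(qK L A m) * √(En L A (m + 1) f)) := by
        refine mul_le_mul_of_nonneg_right ?_ (by positivity)
        exact_mod_cast hd.le
      linarith
    · have h1 := col_le h m f L le_rfl
      have e : (t : ℝ) / (L : ℝ) ^ (m + 1) = (L : ℝ) / L := by
        rw [ht]; push_cast
        rw [div_self (by positivity), div_self (by positivity)]
      rw [e]
      have : 0 ≤ S * √(En L A (m + 1) f) := by positivity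
      linarith

theorem osc_sum {L : ℕ} {A : Finset (ℕ × ℕ)} (h : GoodCarpet L A) (m : ℕ) :
    L * (1 / √(qK L A 0)) + ∑ i ∈ Finset.range m, L * (1 / √(qK L A i)) ≤
      4 * L * (1 + 1 / (1 - √(th L A))) / √(qK L A m) := by
  set r := √(th L A) with hr
  have r0 : 0 ≤ r := Real.sqrt_nonneg _
  have r1 : r < 1 := by
    rw [hr, Real.sqrt_lt' one_pos]; simpa using th_lt h
  have hm := qK_pos h m
  have key : ∀ i, i ≤ m → 1 / √(qK L A i) ≤ 4 * r ^ (m - i) / √(qK L A m) := by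
    intro i hi
    have hi0 := qK_pos h i
    have := qK_th h (m - i) i
    rw [Nat.sub_add_cancel hi] at this
    rw [div_le_div_iff₀ (by positivity) (by positivity), one_mul]
    rw [Real.sqrt_le_iff]
    refine ⟨by positivity, this.trans (le_of_eq ?_)⟩
    rw [mul_pow, Real.sq_sqrt hi0.le, mul_pow, ← pow_mul, mul_comm (m - i) 2, pow_mul, hr,
      Real.sq_sqrt (th_pos h).le]
    norm_num
  have k0 : 1 / √(qK L A 0) ≤ 4 * 1 / √(qK L A m) := by
    refine (key 0 (Nat.zero_le _)).trans ?_
    gcongr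
    exact pow_le_one₀ r0 r1.le
  have k1 : ∑ i ∈ Finset.range m, L * (1 / √(qK L A i)) ≤
      ∑ i ∈ Finset.range m, (4 * L / √(qK L A m)) * r ^ (m - 1 - i) := by
    refine Finset.sum_le_sum fun i hi => ?_
    have hi := Finset.mem_range.1 hi
    have : 1 / √(qK L A i) ≤ 4 * r ^ (m - 1 - i) / √(qK L A m) := by
      refine (key i hi.le).trans ?_
      gcongr ?_ / _
      exact mul_le_mul_of_nonneg_left (pow_le_pow_of_le_one r0 r1.le (by omega)) (by norm_num)
    refine (mul_le_mul_of_nonneg_left this (by positivity)).trans (le_of_eq ?_)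
    ring
  have k1' : ∑ i ∈ Finset.range m, (4 * L / √(qK L A m)) * r ^ (m - 1 - i) =
      (4 * L / √(qK L A m)) * ∑ i ∈ Finset.range m, r ^ i := by
    rw [← Finset.mul_sum, Finset.sum_range_reflect (fun i => r ^ i) m]
  rw [k1'] at k1
  have k2 : ∑ i ∈ Finset.range m, r ^ i ≤ 1 / (1 - r) := by
    have hg := geom_sum_eq r1.ne m
    rw [hg, ← neg_div_neg_eq]
    have : 0 < 1 - r := by linarith
    rw [neg_sub, neg_sub]
    gcongr
    have := pow_nonneg r0 m
    linarith
  have k3 := mul_le_mul_of_nonneg_left k2 (show 0 ≤ 4 * L / √(qK L A m) by positivity)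
  have k4 := mul_le_mul_of_nonneg_left k0 (show (0 : ℝ) ≤ L by positivity)
  calc _ ≤ L * (4 * 1 / √(qK L A m)) + 4 * L / √(qK L A m) * (1 / (1 - r)) := by linarith
    _ = _ := by ring

theorem osc {L : ℕ} {A : Finset (ℕ × ℕ)} (h : GoodCarpet L A) :
    ∃ K : ℝ, 0 < K ∧ ∀ (m : ℕ) (f : ℝ × ℝ → ℝ) (t : ℕ), t ≤ L ^ m →
      |f (0, (t : ℝ) / (L : ℝ) ^ m) - f (0, 0)| ≤ K * √(En L A m f / qK L A m) := by
  have hL : 0 < L := by have := h.three_le; omega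
  have r1 : √(th L A) < 1 := by
    rw [Real.sqrt_lt' one_pos]; simpa using th_lt h
  have : 0 < 1 - √(th L A) := by linarith
  refine ⟨4 * L * (1 + 1 / (1 - √(th L A))), by positivity, fun m f t ht => ?_⟩
  refine (osc1 h m f t ht).trans ?_
  refine (mul_le_mul_of_nonneg_right (osc_sum h m) (Real.sqrt_nonneg _)).trans (le_of_eq ?_)
  rw [Real.sqrt_div (En_nonneg _ _ _ _)]
  ring

theorem zoom {L : ℕ} {A : Finset (ℕ × ℕ)} (h : GoodCarpet L A) (m n : ℕ) :
    ∀ f : ℝ × ℝ → ℝ, En L A m (fun z => f (z.1 / (L : ℝ) ^ n, z.2 / (L : ℝ) ^ n))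
      ≤ En L A (m + n) f := by
  have hL : 0 < L := by have := h.three_le; omega
  induction n with
  | zero => intro f; simp
  | succ n ih =>
    intro f
    have h1 := ih (f ∘ Psi L (0, 0))
    refine le_trans (le_of_eq ?_) (h1.trans (En_sub (m + n) f _ (h.flat_border 0 0 hL hL (by simp))))
    congr 1
    funext z
    simp [Psi, div_div, pow_succ]

theorem eK_diff {L : ℕ} {A : Finset (ℕ × ℕ)} (h : GoodCarpet L A) (k : ℕ) (g : ℝ × ℝ → ℝ)
    (δ : ℝ) (hδ : 0 < δ) (hg : ∀ t : ℕ, t ≤ L ^ k →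
      δ ≤ g (1, (t : ℝ) / (L : ℝ) ^ k) - g (0, (t : ℝ) / (L : ℝ) ^ k)) :
    δ ^ 2 * eK L A k ≤ En L A k g := by
  set G : ℝ × ℝ → ℝ := fun z => max 0 (min 1 ((g z - g (rx z)) / δ / 2 + 1 / 2)) with hG
  have h1 : Cross L k G := by
    intro t ht
    have := hg t ht
    have h2 : 1 ≤ (g (1, (t : ℝ) / (L : ℝ) ^ k) - g (0, (t : ℝ) / (L : ℝ) ^ k)) / δ := by
      rw [le_div_iff₀ hδ]; linarith
    have h3 : (g (0, (t : ℝ) / (L : ℝ) ^ k) - g (1, (t : ℝ) / (L : ℝ) ^ k)) / δ ≤ -1 := by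
      rw [div_le_iff₀ hδ]; linarith
    constructor
    · simp only [hG, rx, sub_zero]
      refine max_eq_left ((min_le_right _ _).trans (by linarith))
    · simp only [hG, rx, sub_self]
      rw [min_eq_left (by linarith)]; norm_num
  have h2 := eK_le L A k G h1
  have h3 : En L A k G ≤ (1 / (2 * δ ^ 2)) * (En L A k g + En L A k (g ∘ rx)) := by
    refine En_dom2 L A _ k _ _ _ fun z z' => ?_
    refine (clamp_sq _ _).trans ?_
    simp only [Function.comp]
    rw [div_mul_eq_mul_div, one_mul, le_div_iff₀ (by positivity)]
    have e : ((g z - g (rx z)) / δ / 2 + 1 / 2 - ((g z' - g (rx z')) / δ / 2 + 1 / 2)) ^ 2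
      * (2 * δ ^ 2) = ((g z - g z') - (g (rx z) - g (rx z'))) ^ 2 / 2 := by
      field_simp
      ring
    rw [e]
    nlinarith [sq_nonneg ((g z - g z') + (g (rx z) - g (rx z')))]
  rw [En_rx h] at h3
  have h4 := h2.trans h3
  rw [div_mul_eq_mul_div, one_mul, le_div_iff₀ (by positivity)] at h4
  linarith

theorem eK_qK {L : ℕ} {A : Finset (ℕ × ℕ)} (h : GoodCarpet L A) :
    ∃ C : ℝ, 0 < C ∧ ∀ m, eK L A m ≤ C * qK L A m := by
  have hL : 0 < L := by have := h.three_le; omega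
  obtain ⟨K, hK, hosc⟩ := osc h
  obtain ⟨n, hn⟩ := exists_pow_lt_of_lt_one (show 0 < 1 / (512 * K ^ 2) by positivity) (th_lt h)
  refine ⟨128 * (L : ℝ) ^ n, by positivity, fun m => ?_⟩
  have hq := qK_pos h m
  have hqn := qK_pos h (m + n)
  obtain ⟨e, ⟨f, f0, f1, rfl⟩, hlt⟩ := exists_lt_of_csInf_lt (qK_nonempty L A (m + n))
    (show qK L A (m + n) < 2 * qK L A (m + n) by linarith)
  have hth := qK_th h n m
  rw [add_comm n m] at hth
  have hE : En L A (m + n) f ≤ 32 * th L A ^ n * qK L A m := by linarith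
  have small : K * √(32 * th L A ^ n) ≤ 1 / 4 := by
    have h1 : 32 * th L A ^ n ≤ (1 / (4 * K)) ^ 2 := by
      have : (1 / (4 * K)) ^ 2 = 32 * (1 / (512 * K ^ 2)) := by field_simp; norm_num
      rw [this]; linarith
    have h2 := Real.sqrt_le_sqrt h1
    rw [Real.sqrt_sq (by positivity)] at h2
    calc K * √(32 * th L A ^ n) ≤ K * (1 / (4 * K)) := mul_le_mul_of_nonneg_left h2 hK.le
      _ = 1 / 4 := by field_simp
  have corner : ∀ g : ℝ × ℝ → ℝ, En L A (m + n) g = En L A (m + n) f → ∀ t : ℕ, t ≤ L ^ m →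
      |g (0, (t : ℝ) / (L : ℝ) ^ m / (L : ℝ) ^ n) - g (0, 0)| ≤ 1 / 4 := by
    intro g hg t ht
    have h1 := hosc m (fun z => g (z.1 / (L : ℝ) ^ n, z.2 / (L : ℝ) ^ n)) t ht
    have h2 := zoom h m n g
    simp only [zero_div] at h1
    refine h1.trans (le_trans ?_ small)
    refine mul_le_mul_of_nonneg_left (Real.sqrt_le_sqrt ?_) hK.le
    rw [div_le_iff₀ hq]
    linarith
  have hd := eK_diff h m ((rowG L)^[n] (f ∘ rx)) (1 / 2) (by norm_num) (by
    intro t ht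
    rw [rowG_iter_diff L hL]
    have c1 := corner f rfl t ht
    have c2 := corner (f ∘ rx) (En_rx h _ f) t ht
    simp only [Function.comp, rx, sub_zero, sub_self] at c2 ⊢
    rw [f0] at c1
    rw [f1] at c2
    rw [abs_le] at c1 c2
    linarith [c1.1, c2.2])
  have hr := rowG_iter_En h m n (f ∘ rx)
  rw [En_rx h] at hr
  have t1 : th L A ^ n ≤ 1 := pow_le_one₀ (th_pos h).le (th_lt h).le
  have h5 : qK L A (m + n) ≤ 16 * qK L A m := by
    refine hth.trans ?_
    nlinarith
  have h6 : En L A (m + n) f ≤ 32 * qK L A m := by linarith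
  have h7 := mul_le_mul_of_nonneg_left h6 (show 0 ≤ (L : ℝ) ^ n by positivity)
  linarith

/-- two-sided comparison for the cell energies -/
theorem cell_main {L : ℕ} {A : Finset (ℕ × ℕ)} (h : GoodCarpet L A) :
    ∃ C : ℝ, 1 ≤ C ∧ ∀ n k, (∀ f, En L A n f / qK L A n ≤ C * (En L A (k + n) f / qK L A (k + n))) ∧
      ∀ f, ∃ g : ℝ × ℝ → ℝ, (∀ z, Lat L n z → g z = f z) ∧
        En L A (k + n) g / qK L A (k + n) ≤ C * (En L A n f / qK L A n) := by
  obtain ⟨C, hC, hCe⟩ := eK_qK h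
  refine ⟨32 * C + 1, by linarith, fun n k => ?_⟩
  have hn := qK_pos h n
  have hk := qK_pos h k
  have hkn := qK_pos h (k + n)
  have u1 : qK L A (k + n) ≤ 8 * C * qK L A k * qK L A n := by
    refine (qK_mul h k n).trans ?_
    have := mul_le_mul_of_nonneg_right (hCe k) hn.le
    linarith
  have u2 : qK L A k * qK L A n ≤ 4 * qK L A (k + n) := by
    have : qK L A k * qK L A n / 4 ≤ qK L A (k + n) := by
      refine le_qK _ _ _ _ fun f f0 f1 => ?_
      have a1 := qK_restrict h k n f
      have a2 := mul_le_mul_of_nonneg_left (qK_le' L A n f f0 f1) hk.le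
      linarith
    linarith
  constructor
  · intro f
    have a1 := qK_restrict h k n f
    have nn := En_nonneg L A n f
    have nn2 := En_nonneg L A (k + n) f
    rw [div_le_iff₀ hn, mul_div_assoc', div_mul_eq_mul_div, le_div_iff₀ hkn]
    calc En L A n f * qK L A (k + n) ≤ En L A n f * (8 * C * qK L A k * qK L A n) :=
          mul_le_mul_of_nonneg_left u1 nn
      _ = 8 * C * qK L A n * (qK L A k * En L A n f) := by ring
      _ ≤ 8 * C * qK L A n * (4 * En L A (k + n) f) :=
          mul_le_mul_of_nonneg_left a1 (by positivity)
      _ ≤ (32 * C + 1) * En L A (k + n) f * qK L A n := by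
          have : 0 ≤ En L A (k + n) f * qK L A n := by positivity
          linarith
  · intro f
    obtain ⟨g, hg, hge⟩ := extension h k n f
    refine ⟨g, hg, ?_⟩
    have nn := En_nonneg L A n f
    rw [div_le_iff₀ hkn, mul_div_assoc', div_mul_eq_mul_div, le_div_iff₀ hn]
    have b1 : En L A (k + n) g ≤ 8 * C * qK L A k * En L A n f := by
      refine hge.trans ?_
      have := mul_le_mul_of_nonneg_right (hCe k) nn
      linarith
    calc En L A (k + n) g * qK L A n ≤ 8 * C * qK L A k * En L A n f * qK L A n :=
          mul_le_mul_of_nonneg_right b1 hn.le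
      _ = 8 * C * En L A n f * (qK L A k * qK L A n) := by ring
      _ ≤ 8 * C * En L A n f * (4 * qK L A (k + n)) :=
          mul_le_mul_of_nonneg_left u2 (by positivity)
      _ ≤ (32 * C + 1) * En L A n f * qK L A (k + n) := by
          have : 0 ≤ En L A n f * qK L A (k + n) := by positivity
          linarith



theorem PsiW_zero (L : ℕ) {A : Finset (ℕ × ℕ)} (w : Word A 0) : PsiW L w = id := by
  simp [PsiW]

theorem PsiW_succ (L : ℕ) {A : Finset (ℕ × ℕ)} {n : ℕ} (w : Word A (n + 1)) :
    PsiW L w = Psi L (w 0).1 ∘ PsiW L (fun i : Fin n => w i.succ) := by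
  simp [PsiW, List.ofFn_succ]

theorem PsiW_cons (L : ℕ) {A : Finset (ℕ × ℕ)} {n : ℕ} (a : {p : ℕ × ℕ // p ∈ A})
    (w : Word A n) :
    PsiW L (Fin.cons a w : Word A (n + 1)) = Psi L a.1 ∘ PsiW L w := by
  rw [PsiW_succ]; simp

theorem En_word (L : ℕ) (A : Finset (ℕ × ℕ)) (n : ℕ) (f : ℝ × ℝ → ℝ) :
    En L A n f = ∑ w : Word A n, En L A 0 (f ∘ PsiW L w) := by
  induction n generalizing f with
  | zero => simp [PsiW_zero]
  | succ n ih =>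
    rw [← (Fin.consEquiv (fun _ : Fin (n + 1) => {p : ℕ × ℕ // p ∈ A})).sum_comp,
      Fintype.sum_prod_type]
    show ∑ a ∈ A, En L A n (f ∘ Psi L a) = _
    rw [← Finset.sum_coe_sort A]
    refine Finset.sum_congr rfl fun a _ => ?_
    rw [ih]
    refine Finset.sum_congr rfl fun w _ => ?_
    show _ = En L A 0 (f ∘ PsiW L (Fin.cons a w : Word A (n + 1)))
    rw [PsiW_cons]; rfl

theorem mem_VN {L : ℕ} {A : Finset (ℕ × ℕ)} {n : ℕ} {x : ℝ × ℝ} :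
    x ∈ VN L A n ↔ ∃ w : Word A n, ∃ p ∈ V0, PsiW L w p = x := by
  simp [VN]

theorem mem_VN_succ {L : ℕ} {A : Finset (ℕ × ℕ)} {n : ℕ} {x : ℝ × ℝ} :
    x ∈ VN L A (n + 1) ↔ ∃ a ∈ A, ∃ y ∈ VN L A n, Psi L a y = x := by
  rw [mem_VN]
  constructor
  · rintro ⟨w, p, hp, rfl⟩
    refine ⟨(w 0).1, (w 0).2, PsiW L (fun i : Fin n => w i.succ) p,
      mem_VN.2 ⟨_, p, hp, rfl⟩, ?_⟩
    rw [PsiW_succ]; rfl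
  · rintro ⟨a, ha, y, hy, rfl⟩
    obtain ⟨w, p, hp, rfl⟩ := mem_VN.1 hy
    refine ⟨(Fin.cons ⟨a, ha⟩ w : Word A (n + 1)), p, hp, ?_⟩
    rw [PsiW_cons]; rfl

theorem mem_VN_zero {L : ℕ} {A : Finset (ℕ × ℕ)} {x : ℝ × ℝ} :
    x ∈ VN L A 0 ↔ x ∈ V0 := by
  rw [mem_VN]
  constructor
  · rintro ⟨w, p, hp, rfl⟩
    rw [PsiW_zero]; exact hp
  · intro hx
    exact ⟨fun i => i.elim0, x, hx, by rw [PsiW_zero]; rfl⟩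

theorem mem_V0 {x : ℝ × ℝ} : x ∈ V0 ↔ (x.1 = 0 ∨ x.1 = 1) ∧ (x.2 = 0 ∨ x.2 = 1) := by
  obtain ⟨x, y⟩ := x
  simp only [V0, Finset.mem_insert, Finset.mem_singleton, Prod.mk.injEq]
  tauto

theorem VN_step {L : ℕ} {A : Finset (ℕ × ℕ)} (h : GoodCarpet L A) (n : ℕ) :
    VN L A n ⊆ VN L A (n + 1) := by
  have hL := h.three_le
  have hL' : ((L - 1 : ℕ) : ℝ) = L - 1 := by
    rw [Nat.cast_sub (by omega)]; simp
  have hL0 : (L : ℝ) ≠ 0 := by positivity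
  induction n with
  | zero =>
    intro x hx
    rw [mem_VN_zero] at hx
    have hx' := mem_V0.1 hx
    rw [mem_VN_succ]
    have e : ∀ t : ℝ, t = 0 ∨ t = 1 → ∃ i : ℕ, i < L ∧ (i = 0 ∨ i = L - 1) ∧ (t + i) / L = t := by
      rintro t (rfl | rfl)
      · exact ⟨0, by omega, by simp, by simp⟩
      · refine ⟨L - 1, by omega, by simp, ?_⟩
        rw [hL']; field_simp; ring
    obtain ⟨i, hi, hi', hi2⟩ := e _ hx'.1
    obtain ⟨j, hj, hj', hj2⟩ := e _ hx'.2
    refine ⟨(i, j), h.flat_border i j hi hj (by tauto), x, mem_VN_zero.2 hx, ?_⟩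
    exact Prod.ext hi2 hj2
  | succ n ih =>
    intro x hx
    obtain ⟨a, ha, y, hy, rfl⟩ := mem_VN_succ.1 hx
    exact mem_VN_succ.2 ⟨a, ha, y, ih hy, rfl⟩

theorem VN_mono {L : ℕ} {A : Finset (ℕ × ℕ)} (h : GoodCarpet L A) (n m : ℕ) (hnm : n ≤ m) :
    VN L A n ⊆ VN L A m := by
  induction m, hnm using Nat.le_induction with
  | base => exact Finset.Subset.refl _
  | succ m _ ih => exact ih.trans (VN_step h m)

theorem PsiW_range {L : ℕ} {A : Finset (ℕ × ℕ)} (h : GoodCarpet L A) {n : ℕ} (w : Word A n)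
    {p : ℝ × ℝ} (hp : p ∈ V0) :
    (0 ≤ (PsiW L w p).1 ∧ (PsiW L w p).1 ≤ 1 ∧ (p.1 = 0 → (PsiW L w p).1 < 1) ∧
      (p.1 = 1 → 0 < (PsiW L w p).1)) ∧
    (0 ≤ (PsiW L w p).2 ∧ (PsiW L w p).2 ≤ 1 ∧ (p.2 = 0 → (PsiW L w p).2 < 1) ∧
      (p.2 = 1 → 0 < (PsiW L w p).2)) := by
  have hL := h.three_le
  have hL0 : (0 : ℝ) < L := by positivity
  induction n with
  | zero =>
    rw [PsiW_zero]
    obtain ⟨h1, h2⟩ := mem_V0.1 hp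
    constructor
    · rcases h1 with h1 | h1 <;> simp [h1]
    · rcases h2 with h1 | h1 <;> simp [h1]
  | succ n ih =>
    rw [PsiW_succ]
    have e : ∀ (t s : ℝ) (a : ℕ), a < L → (0 ≤ t ∧ t ≤ 1 ∧ (s = 0 → t < 1) ∧ (s = 1 → 0 < t)) →
        (0 ≤ (t + a) / L ∧ (t + a) / L ≤ 1 ∧ (s = 0 → (t + a) / L < 1) ∧
          (s = 1 → 0 < (t + a) / L)) := by
      rintro t s a ha ⟨h1, h2, h3, h4⟩
      have ha' : (a : ℝ) + 1 ≤ L := by exact_mod_cast ha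
      have ha0 : (0 : ℝ) ≤ a := by positivity
      refine ⟨by positivity, ?_, ?_, ?_⟩
      · rw [div_le_one hL0]; linarith
      · intro hs
        have := h3 hs
        rw [div_lt_one hL0]; linarith
      · intro hs
        have := h4 hs
        positivity
    have hi := ih (fun i : Fin n => w i.succ)
    exact ⟨e _ _ _ (h.mem_lt _ (w 0).2).1 hi.1, e _ _ _ (h.mem_lt _ (w 0).2).2 hi.2⟩

theorem PsiW_inj {L : ℕ} {A : Finset (ℕ × ℕ)} (h : GoodCarpet L A) {n : ℕ}
    {p : ℝ × ℝ} (hp : p ∈ V0) (w w' : Word A n) (hw : PsiW L w p = PsiW L w' p) : w = w' := by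
  have hL := h.three_le
  have hL0 : (0 : ℝ) < L := by positivity
  induction n with
  | zero => exact Subsingleton.elim _ _
  | succ n ih =>
    rw [PsiW_succ, PsiW_succ] at hw
    have r1 := PsiW_range h (fun i : Fin n => w i.succ) hp
    have r2 := PsiW_range h (fun i : Fin n => w' i.succ) hp
    have hp' := mem_V0.1 hp
    have e : ∀ (t t' s : ℝ) (a b : ℕ), (s = 0 ∨ s = 1) →
        (0 ≤ t ∧ t ≤ 1 ∧ (s = 0 → t < 1) ∧ (s = 1 → 0 < t)) →
        (0 ≤ t' ∧ t' ≤ 1 ∧ (s = 0 → t' < 1) ∧ (s = 1 → 0 < t')) →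
        (t + a) / L = (t' + b) / L → a = b ∧ t = t' := by
      rintro t t' s a b hs ⟨h1, h2, h3, h4⟩ ⟨k1, k2, k3, k4⟩ he
      have he' : t + a = t' + b := by
        field_simp at he; exact he
      have hab : a = b := by
        have u1 : t - t' < 1 := by
          rcases hs with hs | hs
          · have := h3 hs; linarith
          · have := k4 hs; linarith
        have u2 : t' - t < 1 := by
          rcases hs with hs | hs
          · have := k3 hs; linarith
          · have := h4 hs; linarith
        have v1 : (a : ℝ) < b + 1 := by linarith
        have v2 : (b : ℝ) < a + 1 := by linarith
        have v1' : a < b + 1 := by exact_mod_cast v1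
        have v2' : b < a + 1 := by exact_mod_cast v2
        omega
      subst hab
      exact ⟨rfl, by linarith⟩
    have w1 := e _ _ _ _ _ hp'.1 r1.1 r2.1 (congrArg Prod.fst hw)
    have w2 := e _ _ _ _ _ hp'.2 r1.2 r2.2 (congrArg Prod.snd hw)
    have ht := ih _ _ (Prod.ext w1.2 w2.2)
    have h0 : w 0 = w' 0 := Subtype.ext (Prod.ext w1.1 w2.1)
    funext i
    refine Fin.cases h0 (fun j => ?_) i
    exact congrFun ht j


/-- ordered unit edges of the unit square -/
noncomputable def E0 : Finset ((ℝ × ℝ) × (ℝ × ℝ)) := (V0 ×ˢ V0).filter fun z => eudist z.1 z.2 = 1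

theorem En_zero_eq (L : ℕ) (A : Finset (ℕ × ℕ)) (g : ℝ × ℝ → ℝ) :
    En L A 0 g = (1 / 2) * ∑ z ∈ E0, (g z.1 - g z.2) ^ 2 := by
  have s2 : √(1 + 1 : ℝ) ≠ 1 := by
    intro hh
    have := Real.sq_sqrt (show (0 : ℝ) ≤ 1 + 1 by norm_num)
    rw [hh] at this; norm_num at this
  rw [E0, Finset.sum_filter, Finset.sum_product]
  simp only [V0]
  repeat rw [Finset.sum_insert (by simp)]
  simp only [Finset.sum_singleton]
  repeat rw [Finset.sum_insert (by simp)]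
  simp only [Finset.sum_singleton]
  simp [eudist, s2, En]
  ring

theorem eudist_symm (x y : ℝ × ℝ) : eudist x y = eudist y x := by
  unfold eudist; congr 1; ring

theorem Adj_symm (L : ℕ) (A : Finset (ℕ × ℕ)) (n : ℕ) (x y : ℝ × ℝ) (hxy : Adj L A n x y) :
    Adj L A n y x := by
  obtain ⟨w, p, hp, q, hq, hd, hx, hy⟩ := hxy
  exact ⟨w, q, hq, p, hp, by rw [eudist_symm]; exact hd, hy, hx⟩

/-- ordered edges at level n -/
noncomputable def EN (L : ℕ) (A : Finset (ℕ × ℕ)) (n : ℕ) : Finset ((ℝ × ℝ) × (ℝ × ℝ)) :=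
  (VN L A n ×ˢ VN L A n).filter fun z => Adj L A n z.1 z.2

theorem Dform_eq (L : ℕ) (A : Finset (ℕ × ℕ)) (n : ℕ) (f : ℝ × ℝ → ℝ) :
    Dform L A n f = (1 / 2) * ∑ z ∈ EN L A n, (f z.1 - f z.2) ^ 2 := by
  rw [EN, Finset.sum_filter, Finset.sum_product]; rfl

theorem EN_mem (L : ℕ) (A : Finset (ℕ × ℕ)) (n : ℕ) (w : Word A n) {z : (ℝ × ℝ) × (ℝ × ℝ)}
    (hz : z ∈ E0) : (PsiW L w z.1, PsiW L w z.2) ∈ EN L A n := by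
  simp only [E0, EN, Finset.mem_filter, Finset.mem_product] at hz ⊢
  exact ⟨⟨mem_VN.2 ⟨w, _, hz.1.1, rfl⟩, mem_VN.2 ⟨w, _, hz.1.2, rfl⟩⟩,
    w, _, hz.1.1, _, hz.1.2, hz.2, rfl, rfl⟩

theorem En_eq_E0 (L : ℕ) (A : Finset (ℕ × ℕ)) (n : ℕ) (f : ℝ × ℝ → ℝ) :
    En L A n f = (1 / 2) * ∑ z ∈ E0, ∑ w : Word A n, (f (PsiW L w z.1) - f (PsiW L w z.2)) ^ 2 := by
  rw [En_word, Finset.sum_comm, Finset.mul_sum]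
  refine Finset.sum_congr rfl fun w _ => ?_
  rw [En_zero_eq]; rfl

theorem Dform_le_En (L : ℕ) (A : Finset (ℕ × ℕ)) (n : ℕ) (f : ℝ × ℝ → ℝ) :
    Dform L A n f ≤ En L A n f := by
  rw [Dform_eq, En_eq_E0]
  refine mul_le_mul_of_nonneg_left ?_ (by norm_num)
  have hsub : EN L A n ⊆ (E0 ×ˢ (Finset.univ : Finset (Word A n))).image
      (fun u => (PsiW L u.2 u.1.1, PsiW L u.2 u.1.2)) := by
    intro z hz
    simp only [EN, Finset.mem_filter] at hz
    obtain ⟨-, w, p, hp, q, hq, hd, hx, hy⟩ := hz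
    refine Finset.mem_image.2 ⟨((p, q), w), ?_, Prod.ext hx.symm hy.symm⟩
    simp [E0, hp, hq, hd]
  rw [← Finset.sum_product' E0 Finset.univ
    (fun z (w : Word A n) => (f (PsiW L w z.1) - f (PsiW L w z.2)) ^ 2)]
  refine (Finset.sum_le_sum_of_subset_of_nonneg hsub fun _ _ _ => sq_nonneg _).trans ?_
  exact Finset.sum_image_le_of_nonneg fun _ _ => sq_nonneg _

theorem E0_card : (E0.card : ℝ) ≤ 16 := by
  have h1 : E0.card ≤ (V0 ×ˢ V0).card := Finset.card_filter_le _ _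
  have h2 : V0.card ≤ 4 := Finset.card_le_four
  rw [Finset.card_product] at h1
  have : E0.card ≤ 16 := h1.trans (by nlinarith)
  exact_mod_cast this

theorem Dform_nonneg (L : ℕ) (A : Finset (ℕ × ℕ)) (n : ℕ) (f : ℝ × ℝ → ℝ) :
    0 ≤ Dform L A n f := by
  rw [Dform_eq]
  exact mul_nonneg (by norm_num) (Finset.sum_nonneg fun _ _ => sq_nonneg _)

theorem En_le_Dform {L : ℕ} {A : Finset (ℕ × ℕ)} (h : GoodCarpet L A) (n : ℕ) (f : ℝ × ℝ → ℝ) :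
    En L A n f ≤ 16 * Dform L A n f := by
  have h1 : ∀ z ∈ E0, ∑ w : Word A n, (f (PsiW L w z.1) - f (PsiW L w z.2)) ^ 2
      ≤ ∑ z ∈ EN L A n, (f z.1 - f z.2) ^ 2 := by
    intro z hz
    have hz1 : z.1 ∈ V0 := by
      simp only [E0, Finset.mem_filter, Finset.mem_product] at hz
      exact hz.1.1
    have e : ∑ w : Word A n, (f (PsiW L w z.1) - f (PsiW L w z.2)) ^ 2 =
        ∑ y ∈ (Finset.univ : Finset (Word A n)).image (fun w => (PsiW L w z.1, PsiW L w z.2)),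
          (f y.1 - f y.2) ^ 2 := by
      rw [Finset.sum_image]
      intro w _ w' _ hw
      exact PsiW_inj h hz1 w w' (congrArg Prod.fst hw)
    rw [e]
    refine Finset.sum_le_sum_of_subset_of_nonneg ?_ fun _ _ _ => sq_nonneg _
    intro y hy
    obtain ⟨w, -, rfl⟩ := Finset.mem_image.1 hy
    exact EN_mem L A n w hz
  have h2 := Finset.sum_le_card_nsmul _ _ _ h1
  rw [nsmul_eq_mul] at h2
  have h3 := Dform_nonneg L A n f
  rw [En_eq_E0]
  rw [Dform_eq] at h3 ⊢
  have h4 : 0 ≤ ∑ z ∈ EN L A n, (f z.1 - f z.2) ^ 2 := by linarith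
  have h5 := mul_le_mul_of_nonneg_right E0_card h4
  linarith

/-- minimal graph energy between two corners -/
noncomputable def qD (L : ℕ) (A : Finset (ℕ × ℕ)) (n : ℕ) : ℝ :=
  sInf {e : ℝ | ∃ f : ℝ × ℝ → ℝ, (∀ x ∈ ({((0 : ℝ), (0 : ℝ))} : Set (ℝ × ℝ)), f x = 1) ∧
    (∀ x ∈ ({((1 : ℝ), (0 : ℝ))} : Set (ℝ × ℝ)), f x = 0) ∧ e = Dform L A n f}

theorem RR_eq (L : ℕ) (A : Finset (ℕ × ℕ)) (n : ℕ) : RR L A n = (qD L A n)⁻¹ := rfl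

theorem qD_le_qK (L : ℕ) (A : Finset (ℕ × ℕ)) (n : ℕ) : qD L A n ≤ qK L A n := by
  refine le_qK L A n _ fun f h0 h1 => ?_
  refine le_trans ?_ (Dform_le_En L A n f)
  refine csInf_le ⟨0, ?_⟩ ⟨f, by simpa using h0, by simpa using h1, rfl⟩
  rintro e ⟨f, -, -, rfl⟩
  exact Dform_nonneg L A n f

theorem qK_le_qD {L : ℕ} {A : Finset (ℕ × ℕ)} (h : GoodCarpet L A) (n : ℕ) :
    qK L A n ≤ 16 * qD L A n := by
  have : qK L A n / 16 ≤ qD L A n := by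
    refine le_csInf ⟨_, fun z => 1 - z.1, by simp, by simp, rfl⟩ ?_
    rintro e ⟨f, h0, h1, rfl⟩
    have := qK_le' L A n f (h0 _ rfl) (h1 _ rfl)
    have := En_le_Dform h n f
    linarith
  linarith

theorem RD_bounds {L : ℕ} {A : Finset (ℕ × ℕ)} (h : GoodCarpet L A) (n : ℕ) (f : ℝ × ℝ → ℝ) :
    RR L A n * Dform L A n f ≤ 16 * (En L A n f / qK L A n) ∧
    En L A n f / qK L A n ≤ 16 * (RR L A n * Dform L A n f) := by
  have k0 := qK_pos h n
  have k1 := qD_le_qK L A n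
  have k2 := qK_le_qD h n
  have d0 : 0 < qD L A n := by linarith
  have e1 := Dform_le_En L A n f
  have e2 := En_le_Dform h n f
  have e3 := Dform_nonneg L A n f
  rw [RR_eq, inv_mul_eq_div, ← mul_div_assoc, ← mul_div_assoc]
  constructor
  · rw [div_le_div_iff₀ d0 k0]
    nlinarith [mul_nonneg e3 (sub_nonneg.2 k2), mul_nonneg (sub_nonneg.2 e1) d0.le]
  · rw [div_le_div_iff₀ k0 d0]
    nlinarith [mul_nonneg e3 (sub_nonneg.2 k1), mul_nonneg (sub_nonneg.2 e2) d0.le]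

theorem VN_Lat {L : ℕ} {A : Finset (ℕ × ℕ)} (h : GoodCarpet L A) (n : ℕ) :
    ∀ x ∈ VN L A n, Lat L n x := by
  have hL : 0 < L := by have := h.three_le; omega
  induction n with
  | zero =>
    intro x hx
    obtain ⟨h1, h2⟩ := mem_V0.1 (mem_VN_zero.1 hx)
    have e : ∀ t : ℝ, t = 0 ∨ t = 1 → ∃ i : ℕ, i ≤ L ^ 0 ∧ t = (i : ℝ) / (L : ℝ) ^ 0 := by
      rintro t (rfl | rfl)
      · exact ⟨0, by simp, by simp⟩
      · exact ⟨1, by simp, by simp⟩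
    obtain ⟨i, hi, hi'⟩ := e _ h1
    obtain ⟨j, hj, hj'⟩ := e _ h2
    exact ⟨i, j, hi, hj, Prod.ext hi' hj'⟩
  | succ n ih =>
    intro x hx
    obtain ⟨a, ha, y, hy, rfl⟩ := mem_VN_succ.1 hx
    exact Lat_Psi L hL n a (h.mem_lt a ha) y (ih y hy)

theorem QF_RD (L : ℕ) (A : Finset (ℕ × ℕ)) (n : ℕ) (f : ℝ × ℝ → ℝ) :
    QF (VN L A n) (fun x y => RR L A n * if Adj L A n x y then 1 else 0) f =
      RR L A n * Dform L A n f := by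
  unfold QF Dform
  rw [mul_left_comm]
  congr 1
  simp only [Finset.mul_sum]
  refine Finset.sum_congr rfl fun x _ => Finset.sum_congr rfl fun y _ => ?_
  split_ifs <;> ring

/-- Lemma 4.1, planar case: existence of a compatible sequence of
graph energies, comparable to `𝓡_n·D_n` and satisfying the decimation formula. -/
theorem compatible_sequence (L : ℕ) (A : Finset (ℕ × ℕ)) (h : GoodCarpet L A) :
    ∃ c : ℝ, 1 ≤ c ∧
    ∃ κ : ℕ → (ℝ × ℝ) → (ℝ × ℝ) → ℝ, ∃ Dt : ℕ → (ℝ × ℝ → ℝ) → ℝ,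
      -- κ_n is a nonnegative, symmetric conductance
      (∀ n x y, 0 ≤ κ n x y) ∧
      (∀ n x y, κ n x y = κ n y x) ∧
      -- Dt is the quadratic form attached to κ (summing ordered pairs and halving)
      (∀ n (f : ℝ × ℝ → ℝ), Dt n f =
        (1 / 2) * ∑ x ∈ VN L A n, ∑ y ∈ VN L A n, κ n x y * (f x - f y) ^ 2) ∧
      -- (a) comparability with 𝓡_n·D_n
      (∀ n (f : ℝ × ℝ → ℝ),
        c⁻¹ * (RR L A n * Dform L A n f) ≤ Dt n f ∧
        Dt n f ≤ c * (RR L A n * Dform L A n f)) ∧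
      -- (b) decimation formula
      (∀ n m : ℕ, n ≤ m → ∀ f : ℝ × ℝ → ℝ,
        Dt n f = sInf {e : ℝ | ∃ g : ℝ × ℝ → ℝ,
          (∀ x ∈ VN L A n, g x = f x) ∧ e = Dt m g}) := by
  obtain ⟨C, hC, hmain⟩ := cell_main h
  have hc : (1 : ℝ) ≤ 256 * C := by linarith
  have hR : ∀ n, 0 ≤ RR L A n := by
    intro n
    have k0 := qK_pos h n
    have k2 := qK_le_qD h n
    have d0 : 0 < qD L A n := by linarith
    rw [RR_eq]
    exact (inv_pos.2 d0).le
  obtain ⟨κ, k1, k2, k3, k4⟩ := abstract_main (fun n => VN L A n)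
    (fun n m hnm => VN_mono h n m hnm)
    (fun n x y => RR L A n * if Adj L A n x y then 1 else 0)
    (by
      intro n x y
      refine mul_nonneg (hR n) ?_
      split_ifs <;> norm_num)
    (by
      intro n x y
      have : Adj L A n x y ↔ Adj L A n y x := ⟨Adj_symm L A n x y, Adj_symm L A n y x⟩
      simp only [this])
    (256 * C) hc
    (by
      intro n m hnm g
      simp only [QF_RD]
      obtain ⟨k, rfl⟩ := Nat.exists_eq_add_of_le' hnm
      have a1 := (RD_bounds h n g).1
      have a2 := (RD_bounds h (k + n) g).2
      have a3 := (hmain n k).1 g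
      have a4 := mul_le_mul_of_nonneg_left a2 (by linarith : 0 ≤ C)
      linarith)
    (by
      intro n m hnm f
      simp only [QF_RD]
      obtain ⟨k, rfl⟩ := Nat.exists_eq_add_of_le' hnm
      obtain ⟨g, hg, a3⟩ := (hmain n k).2 f
      refine ⟨g, fun x hx => hg x (VN_Lat h n x hx), ?_⟩
      have a1 := (RD_bounds h (k + n) g).1
      have a2 := (RD_bounds h n f).2
      have a4 := mul_le_mul_of_nonneg_left a2 (by linarith : 0 ≤ C)
      linarith)
  refine ⟨256 * C, hc, κ, fun n f => QF (VN L A n) (κ n) f, k1, k2, fun n f => rfl, ?_, k4⟩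
  intro n f
  have := k3 n f
  simp only [QF_RD] at this
  exact this

end Carpet
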